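/- arXiv:1808.10314 — 4 statements merged into one kernel-verified Lean document; each statement's English description precedes it below -/
import Mathlib

section
/- If G₁ and G₂ are melonic SYK graphs, e₁ is a fermionic line of G₁ and e₂ is a fermionic line of G₂, then both gluings G₁^{(e₁)} ⋆ G₂^{(e₂)} and G₁^{(e₁)} ⋆̄ G₂^{(e₂)} are melonic SYK graphs. -/
namespace SYK

/-- A pre-SYK graph: a finite nonempty vertex set `V`, darts `V × Fin q`
(`Fin q` standing for the strand labels `{1,…,q}`), a fixed-point-free
involutive fermionic pairing `ferm` of the darts, and a fixed-point-free
involutive disorder pairing `dis` of the vertices.  (Connectivity of the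
fermionic multigraph is *not* required.) -/
structure PreGraph (q : ℕ) where
  V : Type
  [fintypeV : Fintype V]
  [decEqV : DecidableEq V]
  [nonemptyV : Nonempty V]
  ferm : Equiv.Perm (V × Fin q)
  dis : Equiv.Perm V
  ferm_invol : ∀ d, ferm (ferm d) = d
  ferm_fpf : ∀ d, ferm d ≠ d
  dis_invol : ∀ v, dis (dis v) = v
  dis_fpf : ∀ v, dis v ≠ v

attribute [instance] PreGraph.fintypeV PreGraph.decEqV PreGraph.nonemptyV

variable {q : ℕ}

/-- The darts of a pre-SYK graph. -/
abbrev PreGraph.Dart (H : PreGraph q) : Type := H.V × Fin q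

/-- Relabelling of darts induced by a map of vertices. -/
def dartMap {q : ℕ} {α β : Type} (ι : α → β) (d : α × Fin q) : β × Fin q :=
  (ι d.1, d.2)

/-- The involution `π̂` on darts induced by the disorder pairing:
`π̂ (v, m) = (π v, m)`. -/
def PreGraph.dishat (H : PreGraph q) : Equiv.Perm H.Dart :=
  Equiv.prodCongr H.dis (Equiv.refl (Fin q))

/-- Adjacency of vertices in the fermionic multigraph `G₀`, where fermionic
lines having a dart in `S` are deleted. -/
def PreGraph.adj0Off (H : PreGraph q) (S : Set H.Dart) (v w : H.V) : Prop :=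
  ∃ m m' : Fin q, (v, m) ∉ S ∧ H.ferm (v, m) = (w, m')

/-- Adjacency of vertices in the fermionic multigraph `G₀`. -/
def PreGraph.adj0 (H : PreGraph q) : H.V → H.V → Prop :=
  H.adj0Off ∅

/-- Connectivity of the fermionic multigraph `G₀`. -/
def PreGraph.Conn0 (H : PreGraph q) : Prop :=
  ∀ v w : H.V, Relation.ReflTransGen H.adj0 v w

/-- Adjacency of vertices in the multigraph `G⁺` (one edge per fermionic line
and one edge per disorder line), where fermionic lines having a dart in `S`
are deleted. -/
def PreGraph.adjPlusOff (H : PreGraph q) (S : Set H.Dart) (v w : H.V) : Prop :=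
  H.adj0Off S v w ∨ H.dis v = w

/-- The subgroup of dart permutations generated by the fermionic pairing `τ`
and the induced disorder involution `π̂`; faces are its orbits. -/
def PreGraph.faceGroup (H : PreGraph q) : Subgroup (Equiv.Perm H.Dart) :=
  Subgroup.closure {H.ferm, H.dishat}

/-- Two darts lie in a common face. -/
def PreGraph.SameFace (H : PreGraph q) (d₁ d₂ : H.Dart) : Prop :=
  d₁ ∈ MulAction.orbit H.faceGroup d₂

/-- `F H`: the number of faces, i.e. of orbits of `⟨τ, π̂⟩` on the darts. -/
noncomputable def PreGraph.F (H : PreGraph q) : ℕ :=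
  Nat.card (MulAction.orbitRel.Quotient H.faceGroup H.Dart)

/-- The number of vertices `|V(H)|`. -/
noncomputable def PreGraph.nV (H : PreGraph q) : ℕ :=
  Nat.card H.V

/-- `δ(H) = F(H) − (q−1)·|V(H)|/2` (the division is exact: `|V(H)|` is even). -/
noncomputable def PreGraph.delta (H : PreGraph q) : ℤ :=
  (H.F : ℤ) - ((q : ℤ) - 1) * ((H.nV / 2 : ℕ) : ℤ)

/-- `e` is a fermionic line: the set of the two darts of a `τ`-orbit. -/
def PreGraph.IsLine (H : PreGraph q) (e : Set H.Dart) : Prop :=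
  ∃ d : H.Dart, e = {d, H.ferm d}

/-- The fermionic lines `e₁` and `e₂` belong to a common face. -/
def PreGraph.LinesShareFace (H : PreGraph q) (e₁ e₂ : Set H.Dart) : Prop :=
  ∃ d₁ ∈ e₁, ∃ d₂ ∈ e₂, H.SameFace d₁ d₂

/-- Deleting the fermionic lines with a dart in `S` disconnects `G₀`. -/
def PreGraph.Disconnects0 (H : PreGraph q) (S : Set H.Dart) : Prop :=
  ¬ ∀ v w : H.V, Relation.ReflTransGen (H.adj0Off S) v w

/-- Deleting the fermionic lines with a dart in `S` disconnects `G⁺`. -/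
def PreGraph.DisconnectsPlus (H : PreGraph q) (S : Set H.Dart) : Prop :=
  ¬ ∀ v w : H.V, Relation.ReflTransGen (H.adjPlusOff S) v w

/-- `{e₁, e₂}` is a 2-cut of the multigraph `G⁺`. -/
def PreGraph.TwoCutPlus (H : PreGraph q) (e₁ e₂ : Set H.Dart) : Prop :=
  H.DisconnectsPlus (e₁ ∪ e₂)

/-- `{e₁, e₂}` is a 2-cut of the fermionic multigraph `G₀`. -/
def PreGraph.TwoCut0 (H : PreGraph q) (e₁ e₂ : Set H.Dart) : Prop :=
  H.Disconnects0 (e₁ ∪ e₂)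

/-- An SYK graph: a pre-SYK graph whose fermionic multigraph `G₀` is
connected. -/
structure Graph (q : ℕ) extends PreGraph q where
  conn : toPreGraph.Conn0

/-- `G` is (a relabelling of) the minimal graph `G_min`: two vertices `a, b`
with `π a = b` and `τ (a, m) = (b, m)` for all `m`. -/
def Graph.IsMin (G : Graph q) : Prop :=
  ∃ a b : G.V, a ≠ b ∧ (∀ v : G.V, v = a ∨ v = b) ∧ G.dis a = b ∧
    ∀ m : Fin q, G.ferm (a, m) = (b, m)

/-- `G'` is obtained from `G` by a melonic move: two new vertices `x, y` with
`π x = y` are inserted on a fermionic line `{d, τ d}` of `G`; the strand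
`⟨0, _⟩ : Fin q` plays the role of the label `1` of `{1,…,q}`. -/
def Graph.MelonicMove (G G' : Graph q) : Prop :=
  ∃ (x y : G'.V) (ι : G.V → G'.V) (d : G.V × Fin q),
    Function.Injective ι ∧ x ≠ y ∧
    (∀ v' : G'.V, (¬ ∃ v, ι v = v') ↔ (v' = x ∨ v' = y)) ∧
    G'.dis x = y ∧
    (∀ v, G'.dis (ι v) = ι (G.dis v)) ∧
    G'.ferm (dartMap ι d) = (x, ⟨0, d.2.pos⟩) ∧
    G'.ferm (y, ⟨0, d.2.pos⟩) = dartMap ι (G.ferm d) ∧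
    (∀ k : Fin q, k ≠ ⟨0, d.2.pos⟩ → G'.ferm (x, k) = (y, k)) ∧
    (∀ d' : G.V × Fin q, d' ≠ d → d' ≠ G.ferm d →
      G'.ferm (dartMap ι d') = dartMap ι (G.ferm d'))

/-- Isomorphism of SYK graphs: a bijection of darts commuting with the
fermionic pairings and the induced disorder involutions, and mapping the `q`
darts of each vertex onto the `q` darts of a single vertex. -/
def Graph.Isomorphic (G G' : Graph q) : Prop :=
  ∃ φ : (G.V × Fin q) ≃ (G'.V × Fin q),
    (∀ d, φ (G.ferm d) = G'.ferm (φ d)) ∧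
    (∀ d, φ (G.toPreGraph.dishat d) = G'.toPreGraph.dishat (φ d)) ∧
    ∀ v : G.V, ∃ v' : G'.V, ∀ m : Fin q, (φ (v, m)).1 = v'

/-- `G` is melonic: isomorphic to a graph obtained from the minimal graph
`G_min` by a finite sequence of melonic moves. -/
def Graph.IsMelonic (G : Graph q) : Prop :=
  ∃ G₀ Gn : Graph q, G₀.IsMin ∧ Relation.ReflTransGen Graph.MelonicMove G₀ Gn ∧
    G.Isomorphic Gn


/-- The pre-SYK graph obtained from `H` by replacing the fermionic pairing,
keeping the vertex set and the disorder pairing. -/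
def PreGraph.withFerm (H : PreGraph q) (f : Equiv.Perm (H.V × Fin q))
    (hi : ∀ d, f (f d) = d) (hf : ∀ d, f d ≠ d) : PreGraph q where
  V := H.V
  fintypeV := H.fintypeV
  decEqV := H.decEqV
  nonemptyV := H.nonemptyV
  ferm := f
  dis := H.dis
  ferm_invol := hi
  ferm_fpf := hf
  dis_invol := H.dis_invol
  dis_fpf := H.dis_fpf

/-- `G` is the gluing `G₁^{(e₁)} ⋆ G₂^{(e₂)}` where `e₁ = {d₁, τ₁ d₁}` and
`e₂ = {d₂, τ₂ d₂}`: the vertex set is the disjoint union of those of `G₁` and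
`G₂`, the disorder pairing is the union of the two disorder pairings, and the
fermionic pairing agrees with `τ₁`, `τ₂` outside `e₁ ∪ e₂` and pairs `d₁` with
`d₂`, and `τ₁ d₁` with `τ₂ d₂`. -/
def Graph.IsStarGluing (G₁ G₂ G : Graph q) (d₁ : G₁.V × Fin q)
    (d₂ : G₂.V × Fin q) : Prop :=
  ∃ (ι₁ : G₁.V → G.V) (ι₂ : G₂.V → G.V),
    Function.Injective ι₁ ∧ Function.Injective ι₂ ∧
    (∀ v₁ v₂, ι₁ v₁ ≠ ι₂ v₂) ∧
    (∀ v : G.V, (∃ v₁, ι₁ v₁ = v) ∨ (∃ v₂, ι₂ v₂ = v)) ∧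
    (∀ v, G.dis (ι₁ v) = ι₁ (G₁.dis v)) ∧
    (∀ v, G.dis (ι₂ v) = ι₂ (G₂.dis v)) ∧
    G.ferm (dartMap ι₁ d₁) = dartMap ι₂ d₂ ∧
    G.ferm (dartMap ι₁ (G₁.ferm d₁)) = dartMap ι₂ (G₂.ferm d₂) ∧
    (∀ d, d ≠ d₁ → d ≠ G₁.ferm d₁ →
      G.ferm (dartMap ι₁ d) = dartMap ι₁ (G₁.ferm d)) ∧
    (∀ d, d ≠ d₂ → d ≠ G₂.ferm d₂ →
      G.ferm (dartMap ι₂ d) = dartMap ι₂ (G₂.ferm d))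

/-- `G` is the gluing `G₁^{(e₁)} ⋆̄ G₂^{(e₂)}`: as in `IsStarGluing` but the
fermionic pairing pairs `d₁` with `τ₂ d₂`, and `τ₁ d₁` with `d₂`. -/
def Graph.IsBarGluing (G₁ G₂ G : Graph q) (d₁ : G₁.V × Fin q)
    (d₂ : G₂.V × Fin q) : Prop :=
  ∃ (ι₁ : G₁.V → G.V) (ι₂ : G₂.V → G.V),
    Function.Injective ι₁ ∧ Function.Injective ι₂ ∧
    (∀ v₁ v₂, ι₁ v₁ ≠ ι₂ v₂) ∧
    (∀ v : G.V, (∃ v₁, ι₁ v₁ = v) ∨ (∃ v₂, ι₂ v₂ = v)) ∧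
    (∀ v, G.dis (ι₁ v) = ι₁ (G₁.dis v)) ∧
    (∀ v, G.dis (ι₂ v) = ι₂ (G₂.dis v)) ∧
    G.ferm (dartMap ι₁ d₁) = dartMap ι₂ (G₂.ferm d₂) ∧
    G.ferm (dartMap ι₁ (G₁.ferm d₁)) = dartMap ι₂ d₂ ∧
    (∀ d, d ≠ d₁ → d ≠ G₁.ferm d₁ →
      G.ferm (dartMap ι₁ d) = dartMap ι₁ (G₁.ferm d)) ∧
    (∀ d, d ≠ d₂ → d ≠ G₂.ferm d₂ →
      G.ferm (dartMap ι₂ d) = dartMap ι₂ (G₂.ferm d))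

/-- `H''` is the contraction of the disorder line `{v, w}` of `H`: its vertex
set is `V(H) ∖ {v, w}` (embedded via `ι`), its disorder pairing is the
restriction of that of `H`, and its fermionic pairing pairs `τ (v, m)` with
`τ (w, m)` for each strand `m` and agrees with `τ` on all other darts. -/
def PreGraph.IsContraction (H H'' : PreGraph q) (v w : H.V) : Prop :=
  ∃ ι : H''.V → H.V,
    Function.Injective ι ∧
    (∀ u : H.V, (∃ u'', ι u'' = u) ↔ (u ≠ v ∧ u ≠ w)) ∧
    (∀ u, ι (H''.dis u) = H.dis (ι u)) ∧
    (∀ m : Fin q, ∃ a b : H''.V × Fin q,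
      dartMap ι a = H.ferm (v, m) ∧ dartMap ι b = H.ferm (w, m) ∧
      H''.ferm a = b) ∧
    (∀ d : H''.V × Fin q,
      (∀ m : Fin q, dartMap ι d ≠ H.ferm (v, m) ∧ dartMap ι d ≠ H.ferm (w, m)) →
      dartMap ι (H''.ferm d) = H.ferm (dartMap ι d))

/-- `HL` is the closure of the side `side ⊆ V(G)` of the graph `G` cut along
the fermionic lines `e₁, e₂`: its vertex set is `{v | side v}` (embedded via
`ι`), its disorder pairing is the restriction of that of `G`, and its
fermionic pairing pairs the `side`-dart of `e₁` with the `side`-dart of `e₂`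
and agrees with `τ` on all darts not in `e₁ ∪ e₂`. -/
def Graph.IsSideClose (G : Graph q) (side : G.V → Prop)
    (e₁ e₂ : Set (G.V × Fin q)) (HL : PreGraph q) : Prop :=
  ∃ ι : HL.V → G.V,
    Function.Injective ι ∧
    (∀ v : G.V, (∃ u, ι u = v) ↔ side v) ∧
    (∀ u, ι (HL.dis u) = G.dis (ι u)) ∧
    (∃ a b : HL.V × Fin q, dartMap ι a ∈ e₁ ∧ dartMap ι b ∈ e₂ ∧
      HL.ferm a = b) ∧
    (∀ d : HL.V × Fin q, dartMap ι d ∉ e₁ ∪ e₂ →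
      dartMap ι (HL.ferm d) = G.ferm (dartMap ι d))


/-- The structure carried by the darts of an SYK graph: the fermionic pairing, the disorder
involution, and the relation of being carried by the same vertex. -/
structure DartSystem where
  D : Type
  ferm : D → D
  dis : D → D
  sim : D → D → Prop
  ferm_invol : ∀ d, ferm (ferm d) = d
  ferm_fpf : ∀ d, ferm d ≠ d

namespace DartSystem

/-- Isomorphism of dart systems. -/
structure Iso (A B : DartSystem) extends A.D ≃ B.D where
  map_ferm : ∀ d, toFun (A.ferm d) = B.ferm (toFun d)
  map_dis : ∀ d, toFun (A.dis d) = B.dis (toFun d)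
  map_sim : ∀ d d', A.sim d d' ↔ B.sim (toFun d) (toFun d')

namespace Iso

variable {A B C : DartSystem}

def refl (A : DartSystem) : Iso A A :=
  ⟨Equiv.refl _, fun _ => rfl, fun _ => rfl, fun _ _ => Iff.rfl⟩

def symm (f : Iso A B) : Iso B A where
  toEquiv := f.toEquiv.symm
  map_ferm d := by
    have := f.map_ferm (f.toEquiv.symm d)
    simp_all [Equiv.symm_apply_eq]
  map_dis d := by
    have := f.map_dis (f.toEquiv.symm d)
    simp_all [Equiv.symm_apply_eq]
  map_sim d d' := by
    have := f.map_sim (f.toEquiv.symm d) (f.toEquiv.symm d')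
    simp_all

def trans (f : Iso A B) (g : Iso B C) : Iso A C where
  toEquiv := f.toEquiv.trans g.toEquiv
  map_ferm d := (congrArg g.toEquiv (f.map_ferm d)).trans (g.map_ferm _)
  map_dis d := (congrArg g.toEquiv (f.map_dis d)).trans (g.map_dis _)
  map_sim d d' := (f.map_sim d d').trans (g.map_sim _ _)

end Iso

open Classical in
/-- The fermionic pairing of the gluing of two pairings `f` and `g`, pairing `a` with `b` and `f a`
with `g b`. -/
noncomputable def glueFerm {α β : Type} (f : α → α) (g : β → β) (a : α) (b : β) :
    α ⊕ β → α ⊕ β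
  | .inl x => if x = a then .inr b else if x = f a then .inr (g b) else .inl (f x)
  | .inr y => if y = b then .inl a else if y = g b then .inl (f a) else .inr (g y)

/-- The gluing of dart systems along the lines `{a, τ a}` and `{b, τ b}`. -/
noncomputable def glue (A B : DartSystem) (a : A.D) (b : B.D) : DartSystem where
  D := A.D ⊕ B.D
  ferm := glueFerm A.ferm B.ferm a b
  dis := Sum.map A.dis B.dis
  sim := Sum.LiftRel A.sim B.sim
  ferm_invol d := by
    have := A.ferm_invol
    have := B.ferm_invol
    have := A.ferm_fpf
    have := B.ferm_fpf
    rcases d with x | y <;> grind [glueFerm]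
  ferm_fpf d := by
    have := A.ferm_fpf
    have := B.ferm_fpf
    rcases d with x | y <;> grind [glueFerm]

variable {A B C : DartSystem}

/-- Gluing respects isomorphisms. -/
noncomputable def glueCongr {A' B' : DartSystem} (f : Iso A A') (g : Iso B B') (a : A.D) (b : B.D) :
    Iso (glue A B a b) (glue A' B' (f.toEquiv a) (g.toEquiv b)) where
  toEquiv := Equiv.sumCongr f.toEquiv g.toEquiv
  map_ferm d := by
    have hf := f.map_ferm
    have hg := g.map_ferm
    have hfi := f.toEquiv.injective
    have hgi := g.toEquiv.injective
    simp only [Equiv.toFun_as_coe] at hf hg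
    rcases d with x | y <;>
      simp only [glue, glueFerm, Equiv.toFun_as_coe, Equiv.sumCongr_apply, Sum.map_inl,
        Sum.map_inr] <;>
      grind
  map_dis d := by
    rcases d with x | y
    · exact congrArg Sum.inl (f.map_dis x)
    · exact congrArg Sum.inr (g.map_dis y)
  map_sim d d' := by
    have hf := f.map_sim
    have hg := g.map_sim
    rcases d with x | y <;> rcases d' with x' | y' <;> simp_all [glue]

/-- Gluing is commutative. -/
noncomputable def glueComm (A B : DartSystem) (a : A.D) (b : B.D) :
    Iso (glue A B a b) (glue B A b a) where
  toEquiv := Equiv.sumComm _ _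
  map_ferm d := by
    rcases d with x | y <;> simp only [glue, glueFerm] <;> split_ifs <;> simp_all
  map_dis d := by rcases d with x | y <;> rfl
  map_sim d d' := by rcases d with x | y <;> rcases d' with x' | y' <;> simp [glue]

/-- Exchanging the darts of both lines does not change the gluing. -/
noncomputable def glueFlip (A B : DartSystem) (a : A.D) (b : B.D) :
    Iso (glue A B a b) (glue A B (A.ferm a) (B.ferm b)) where
  toEquiv := Equiv.refl _
  map_ferm d := by
    have := A.ferm_invol
    have := B.ferm_invol
    have := A.ferm_fpf
    have := B.ferm_fpf
    rcases d with x | y <;> simp only [glue, glueFerm, Equiv.toFun_as_coe, Equiv.refl_apply] <;>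
      grind
  map_dis _ := rfl
  map_sim _ _ := Iff.rfl

theorem glueFerm_assoc_of_ne {α β γ : Type} {f : α → α} {g : β → β} {k : γ → γ}
    (hg : ∀ x, g (g x) = x) (hg' : ∀ x, g x ≠ x)
    (a : α) (b b' : β) (c : γ) (h : b' ≠ b) (h' : b' ≠ g b) (d : α ⊕ β ⊕ γ) :
    (Equiv.sumAssoc α β γ).symm (glueFerm f (glueFerm g k b c) a (.inl b') d) =
      glueFerm (glueFerm f g a b') k (.inr b) c ((Equiv.sumAssoc α β γ).symm d) := by
  rcases d with x | y | z <;>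
    simp only [glueFerm, Equiv.sumAssoc_symm_apply_inl, Equiv.sumAssoc_symm_apply_inr_inl,
      Equiv.sumAssoc_symm_apply_inr_inr, Sum.inl.injEq, Sum.inr.injEq, reduceCtorEq, if_false] <;>
    grind [Equiv.sumAssoc_symm_apply_inl, Equiv.sumAssoc_symm_apply_inr_inl,
      Equiv.sumAssoc_symm_apply_inr_inr]

theorem glueFerm_assoc_self {α β γ : Type} {f : α → α} {g : β → β} {k : γ → γ}
    (hf : ∀ x, f (f x) = x) (hf' : ∀ x, f x ≠ x) (hg' : ∀ x, g x ≠ x)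
    (a : α) (b : β) (c : γ) (d : α ⊕ β ⊕ γ) :
    (Equiv.sumAssoc α β γ).symm (glueFerm f (glueFerm g k b c) a (.inl b) d) =
      glueFerm (glueFerm f g a b) k (.inl (f a)) c ((Equiv.sumAssoc α β γ).symm d) := by
  rcases d with x | y | z <;>
    simp only [glueFerm, Equiv.sumAssoc_symm_apply_inl, Equiv.sumAssoc_symm_apply_inr_inl,
      Equiv.sumAssoc_symm_apply_inr_inr, Sum.inl.injEq, reduceCtorEq, if_false] <;>
    grind [Equiv.sumAssoc_symm_apply_inl, Equiv.sumAssoc_symm_apply_inr_inl,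
      Equiv.sumAssoc_symm_apply_inr_inr]

/-- Associativity of gluing along three lines, the middle system being glued along two distinct
lines. -/
noncomputable def glueAssocOfNe (a : A.D) (b b' : B.D) (c : C.D) (h : b' ≠ b)
    (h' : b' ≠ B.ferm b) :
    Iso (glue A (glue B C b c) a (.inl b')) (glue (glue A B a b') C (.inr b) c) where
  toEquiv := (Equiv.sumAssoc _ _ _).symm
  map_ferm := glueFerm_assoc_of_ne B.ferm_invol B.ferm_fpf a b b' c h h'
  map_dis d := by rcases d with x | y | z <;> rfl
  map_sim d d' := by
    rcases d with x | y | z <;> rcases d' with x' | y' | z' <;> simp [glue]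

/-- Associativity of gluing along three lines, the middle system being glued twice along the same
line. -/
noncomputable def glueAssocSelf (a : A.D) (b : B.D) (c : C.D) :
    Iso (glue A (glue B C b c) a (.inl b)) (glue (glue A B a b) C (.inl (A.ferm a)) c) where
  toEquiv := (Equiv.sumAssoc _ _ _).symm
  map_ferm := glueFerm_assoc_self A.ferm_invol A.ferm_fpf B.ferm_fpf a b c
  map_dis d := by rcases d with x | y | z <;> rfl
  map_sim d d' := by
    rcases d with x | y | z <;> rcases d' with x' | y' | z' <;> simp [glue]

/-- Reassociating a gluing along an arbitrary line of the first factor of a gluing. -/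
theorem exists_glue_assoc (a : A.D) (b b' : B.D) (c : C.D) :
    ∃ l c', Nonempty (Iso (glue A (glue B C b c) a (.inl b')) (glue (glue A B a b') C l c')) := by
  by_cases h : b' = b
  · subst h
    exact ⟨_, _, ⟨glueAssocSelf a b' c⟩⟩
  by_cases h' : b' = B.ferm b
  · subst h'
    exact ⟨_, _, ⟨(glueCongr (Iso.refl A) (glueFlip B C b c) a (.inl (B.ferm b))).trans
      (glueAssocSelf a _ _)⟩⟩
  · exact ⟨_, _, ⟨glueAssocOfNe a b b' c h h'⟩⟩

/-- No colouring of the darts constant on vertices separates the darts of `A`. -/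
def Connected (A : DartSystem) : Prop :=
  ∀ c : A.D → Prop, (∀ x y, A.sim x y → c x → c y) → (∀ x, c x → c (A.ferm x)) →
    ∀ x y, c x → c y

/-- `A` stays connected when the fermionic line of `e` is deleted. -/
def ConnectedOff (A : DartSystem) (e : A.D) : Prop :=
  ∀ c : A.D → Prop, (∀ x y, A.sim x y → c x → c y) →
    (∀ x, x ≠ e → x ≠ A.ferm e → c x → c (A.ferm x)) → ∀ x y, c x → c y

/-- `A` stays connected when any one fermionic line is deleted. -/
def Bridgeless (A : DartSystem) : Prop :=
  ∀ e : A.D, A.ConnectedOff e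

theorem ConnectedOff.of_iso {e : A.D} (h : A.ConnectedOff e) (f : Iso A B) :
    B.ConnectedOff (f.toEquiv e) := by
  intro c hs hc x y hx
  have hf : ∀ d, f.toEquiv (A.ferm d) = B.ferm (f.toEquiv d) := f.map_ferm
  have key := h (fun x => c (f.toEquiv x))
    (fun x y hxy => hs _ _ ((f.map_sim x y).1 hxy)) (fun x h1 h2 hx => by
      rw [hf]
      refine hc _ (fun h => h1 (f.toEquiv.injective h)) (fun h => h2 ?_) hx
      exact f.toEquiv.injective (by rw [h, hf])) (f.toEquiv.symm x) (f.toEquiv.symm y)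
  simpa [hx] using key

theorem Bridgeless.of_iso (h : A.Bridgeless) (f : Iso A B) : B.Bridgeless := fun e => by
  simpa using (h (f.toEquiv.symm e)).of_iso f

theorem Bridgeless.connected (hA : A.Bridgeless) : A.Connected :=
  fun c hs hc x => hA x c hs (fun y _ _ => hc y) x

theorem Bridgeless.glue_connectedOff_inl (hA : A.Bridgeless) (hB : B.Bridgeless) (a : A.D)
    (b : B.D) (e : A.D) : (glue A B a b).ConnectedOff (.inl e) := by
  intro c hs hc
  have hAi := A.ferm_invol
  have hBi := B.ferm_invol
  have hAf := A.ferm_fpf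
  have hBf := B.ferm_fpf
  simp only [glue] at c hc
  have hinr : ∀ x y, c (.inr x) → c (.inr y) := by
    refine hB b (fun x => c (.inr x)) (fun x y h => hs _ _ (.inr h)) fun x h1 h2 hx => ?_
    have := hc (.inr x) (by simp) (by grind [glueFerm]) hx
    simpa [glueFerm, h1, h2] using this
  have hsl : ∀ x y, A.sim x y → c (.inl x) → c (.inl y) := fun x y h => hs _ _ (.inl h)
  clear hs
  have hab : e ≠ a → (c (.inl a) ↔ c (.inr b)) := by
    have := hc (.inl a)
    have := hc (.inr b)
    grind [glueFerm, Sum.inl.injEq, Sum.inr.injEq]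
  have hab' : e ≠ A.ferm a → (c (.inl (A.ferm a)) ↔ c (.inr (B.ferm b))) := by
    have := hc (.inl (A.ferm a))
    have := hc (.inr (B.ferm b))
    grind [glueFerm, Sum.inl.injEq, Sum.inr.injEq]
  have hinl : ∀ x y, c (.inl x) → c (.inl y) := by
    refine hA e (fun x => c (.inl x)) hsl fun x h1 h2 hx => ?_
    have := hc (.inl x)
    have := hinr b (B.ferm b)
    have := hinr (B.ferm b) b
    grind [glueFerm, Sum.inl.injEq, Sum.inr.injEq]
  have hlr : ∃ x y, c (.inl x) ↔ c (.inr y) := by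
    by_cases h : e = a
    · exact ⟨_, _, hab' (by grind)⟩
    · exact ⟨_, _, hab h⟩
  obtain ⟨x₀, y₀, h₀⟩ := hlr
  rintro (x | x) (y | y) h
  · exact hinl _ _ h
  · exact hinr _ _ (h₀.1 (hinl _ _ h))
  · exact hinl _ _ (h₀.2 (hinr _ _ h))
  · exact hinr _ _ h

theorem Bridgeless.glue (hA : A.Bridgeless) (hB : B.Bridgeless) (a : A.D) (b : B.D) :
    (glue A B a b).Bridgeless := by
  rintro (e | e)
  · exact hA.glue_connectedOff_inl hB a b e
  · exact (hB.glue_connectedOff_inl hA b a e).of_iso (glueComm B A b a)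

end DartSystem

section

open DartSystem

/-- The dart system of a pre-SYK graph. -/
def PreGraph.darts (H : PreGraph q) : DartSystem where
  D := H.V × Fin q
  ferm := H.ferm
  dis := H.dishat
  sim d d' := d.1 = d'.1
  ferm_invol := H.ferm_invol
  ferm_fpf := H.ferm_fpf

theorem PreGraph.conn0_of_connected (hq : 0 < q) {H : PreGraph q} (h : H.darts.Connected) :
    H.Conn0 := fun v w =>
  h (fun d => Relation.ReflTransGen H.adj0 v d.1) (fun _ _ hxy hx => Eq.subst hxy hx)
    (fun x hx => hx.tail ⟨x.2, (H.ferm x).2, Set.notMem_empty _, rfl⟩) (v, ⟨0, hq⟩) (w, ⟨0, hq⟩) .refl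

theorem Graph.Isomorphic.exists_iso {G G' : Graph q} (h : G.Isomorphic G') :
    Nonempty (Iso G.darts G'.darts) := by
  obtain ⟨φ, hf, hd, hv⟩ := h
  choose f hv using hv
  refine ⟨⟨φ, hf, hd, fun d d' => ?_⟩⟩
  obtain ⟨v, m⟩ := d
  obtain ⟨w, n⟩ := d'
  change v = w ↔ (φ (v, m)).1 = (φ (w, n)).1
  rw [hv, hv]
  refine ⟨congrArg f, fun h => ?_⟩
  have hinj : Function.Injective fun k => (φ (v, k)).2 := fun k l hkl =>
    congrArg Prod.snd (φ.injective (Prod.ext ((hv v k).trans (hv v l).symm) hkl))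
  obtain ⟨k, hk⟩ := Finite.surjective_of_injective hinj (φ (w, n)).2
  exact congrArg Prod.fst (φ.injective (Prod.ext ((hv v k).trans (h.trans (hv w n).symm)) hk))

theorem Graph.isomorphic_of_iso (hq : 0 < q) {G G' : Graph q} (f : Iso G.darts G'.darts) :
    G.Isomorphic G' :=
  ⟨f.toEquiv, f.map_ferm, f.map_dis, fun v => ⟨(f.toEquiv (v, ⟨0, hq⟩)).1, fun m =>
    (f.map_sim (v, m) (v, ⟨0, hq⟩)).1 rfl⟩⟩

/-- The minimal graph, with vertices `false` and `true`. -/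
def minPreGraph (q : ℕ) : PreGraph q where
  V := Bool
  ferm := Equiv.prodCongr Equiv.boolNot (Equiv.refl _)
  dis := Equiv.boolNot
  ferm_invol d := Prod.ext (Bool.not_not d.1) rfl
  ferm_fpf d := by simp [Prod.ext_iff]
  dis_invol v := by simp
  dis_fpf v := by simp

/-- The dart system of the minimal graph. -/
abbrev minDarts (q : ℕ) : DartSystem := (minPreGraph q).darts

theorem minDarts_bridgeless (hq : 2 ≤ q) : (minDarts q).Bridgeless := by
  rintro ⟨b, m⟩ c hs hc ⟨x, k⟩ ⟨y, l⟩ hx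
  have : Nontrivial (Fin q) := Fin.nontrivial_iff_two_le.2 hq
  obtain ⟨n, hn⟩ := exists_ne m
  have hxn : c (x, n) := hs (x, k) (x, n) rfl hx
  have hxn' : c (!x, n) := hc (x, n) (fun h => hn (congrArg Prod.snd h))
    (fun h => hn (congrArg Prod.snd h)) hxn
  refine hs (y, n) (y, l) rfl ?_
  cases x <;> cases y <;> assumption

/-- The minimal graph as an SYK graph. -/
def minGraph (hq : 2 ≤ q) : Graph q where
  toPreGraph := minPreGraph q
  conn := PreGraph.conn0_of_connected (by lia) (minDarts_bridgeless hq).connected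

theorem minGraph_isMin (hq : 2 ≤ q) : (minGraph hq).IsMin :=
  ⟨false, true, Bool.false_ne_true, fun v => Bool.eq_false_or_eq_true v |>.symm, rfl, fun _ => rfl⟩

theorem Graph.IsMin.exists_iso {G : Graph q} (h : G.IsMin) :
    Nonempty (Iso (minDarts q) G.darts) := by
  obtain ⟨a, b, hab, hcov, hdis, hferm⟩ := h
  have hdis' : G.dis b = a := by rw [← hdis, G.dis_invol]
  have hferm' : ∀ m, G.ferm (b, m) = (a, m) := fun m => by rw [← hferm, G.ferm_invol]
  have hbij : Function.Bijective fun x : Bool => cond x b a := by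
    refine ⟨fun x y h => ?_, fun v => ?_⟩
    · cases x <;> cases y <;> simp_all
    · rcases hcov v with rfl | rfl
      · exact ⟨false, rfl⟩
      · exact ⟨true, rfl⟩
  refine ⟨⟨Equiv.prodCongr (Equiv.ofBijective _ hbij) (Equiv.refl _), ?_, ?_, ?_⟩⟩
  · rintro ⟨x, m⟩
    cases x
    · exact (hferm m).symm
    · exact (hferm' m).symm
  · rintro ⟨x, m⟩
    cases x
    · exact congrArg (·, m) hdis.symm
    · exact congrArg (·, m) hdis'.symm
  · rintro ⟨x, m⟩ ⟨y, n⟩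
    exact hbij.1.eq_iff.symm

/-- The automorphism group of the minimal graph acts transitively on its darts. -/
theorem exists_minDarts_iso (d d' : Bool × Fin q) :
    ∃ f : Iso (minDarts q) (minDarts q), f.toEquiv d = d' := by
  obtain ⟨g, hg, hgd⟩ : ∃ g : Equiv.Perm Bool, (∀ x, g (!x) = !(g x)) ∧ g d.1 = d'.1 := by
    by_cases h : d.1 = d'.1
    · exact ⟨Equiv.refl _, fun _ => rfl, h⟩
    · exact ⟨Equiv.boolNot, fun _ => rfl, (Bool.eq_not_of_ne (Ne.symm h)).symm⟩
  refine ⟨⟨Equiv.prodCongr g (Equiv.swap d.2 d'.2), ?_, ?_, ?_⟩, ?_⟩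
  · exact fun x => Prod.ext (hg x.1) rfl
  · exact fun x => Prod.ext (hg x.1) rfl
  · exact fun x y => g.injective.eq_iff.symm
  · exact Prod.ext hgd (Equiv.swap_apply_left _ _)

namespace DartSystem

/-- The dart systems obtained from the minimal one by successive gluings with the minimal one. -/
inductive Melonic (q : ℕ) : DartSystem → Prop
  | min : Melonic q (minDarts q)
  | glue {A : DartSystem} (hA : Melonic q A) (a : A.D) (b : (minDarts q).D) :
      Melonic q (A.glue (minDarts q) a b)
  | iso {A B : DartSystem} (hA : Melonic q A) (f : Iso A B) : Melonic q B

theorem Melonic.bridgeless (hq : 2 ≤ q) {A : DartSystem} (hA : A.Melonic q) : A.Bridgeless := by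
  induction hA with
  | min => exact minDarts_bridgeless hq
  | glue _ a b ih => exact ih.glue (minDarts_bridgeless hq) a b
  | iso _ f ih => exact ih.of_iso f

theorem Melonic.glue_melonic {A B : DartSystem} (hA : A.Melonic q) (hB : B.Melonic q) (a : A.D)
    (b : B.D) : (A.glue B a b).Melonic q := by
  induction hB generalizing A with
  | min => exact hA.glue a b
  | iso _ f ih =>
    have := (ih hA a (f.toEquiv.symm b)).iso (glueCongr (Iso.refl A) f a (f.toEquiv.symm b))
    rwa [f.toEquiv.apply_symm_apply] at this
  | @glue B _ b₀ m ih =>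
    rcases b with b | n
    · obtain ⟨l, c, ⟨f⟩⟩ := exists_glue_assoc a b₀ b m
      exact ((ih hA a b).glue l c).iso f.symm
    · obtain ⟨l, c, ⟨f⟩⟩ := exists_glue_assoc a m n b₀
      exact (ih (hA.glue a n) l c).iso (f.symm.trans
        (glueCongr (Iso.refl A) (glueComm (minDarts q) B m b₀) a (.inl n)))

end DartSystem

theorem Graph.IsStarGluing.exists_iso {G₁ G₂ G : Graph q} {d₁ : G₁.V × Fin q}
    {d₂ : G₂.V × Fin q} (h : IsStarGluing G₁ G₂ G d₁ d₂) :
    Nonempty (Iso (G₁.darts.glue G₂.darts d₁ d₂) G.darts) := by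
  obtain ⟨ι₁, ι₂, hi₁, hi₂, hne, hcov, hdis₁, hdis₂, hf, hf', hf₁, hf₂⟩ := h
  have hinj₁ : Function.Injective (dartMap (q := q) ι₁) := fun x y h =>
    Prod.ext (hi₁ (Prod.mk.inj h).1) (Prod.mk.inj h).2
  have hinj₂ : Function.Injective (dartMap (q := q) ι₂) := fun x y h =>
    Prod.ext (hi₂ (Prod.mk.inj h).1) (Prod.mk.inj h).2
  have hbij : Function.Bijective (Sum.elim (dartMap (q := q) ι₁) (dartMap (q := q) ι₂)) := by
    refine ⟨hinj₁.sumElim hinj₂ fun x y h => hne _ _ (congrArg Prod.fst h), ?_⟩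
    rintro ⟨v, m⟩
    rcases hcov v with ⟨w, rfl⟩ | ⟨w, rfl⟩
    · exact ⟨.inl (w, m), rfl⟩
    · exact ⟨.inr (w, m), rfl⟩
  refine ⟨⟨Equiv.ofBijective _ hbij, ?_, ?_, ?_⟩⟩
  · have hferm₁ : ∀ x, Sum.elim (dartMap ι₁) (dartMap ι₂) (glueFerm G₁.ferm G₂.ferm d₁ d₂ (.inl x)) =
        G.ferm (dartMap ι₁ x) := fun x => by
      simp only [glueFerm]
      split_ifs with h h'
      · rw [h, hf]; rfl
      · rw [h', hf']; rfl
      · rw [hf₁ x h h']; rfl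
    have hferm₂ : ∀ x, Sum.elim (dartMap ι₁) (dartMap ι₂) (glueFerm G₁.ferm G₂.ferm d₁ d₂ (.inr x)) =
        G.ferm (dartMap ι₂ x) := fun x => by
      simp only [glueFerm]
      split_ifs with h h'
      · rw [h, ← hf, G.ferm_invol]; rfl
      · rw [h', ← hf', G.ferm_invol]; rfl
      · rw [hf₂ x h h']; rfl
    rintro (x | x)
    · exact hferm₁ x
    · exact hferm₂ x
  · rintro (x | x)
    · exact Prod.ext (hdis₁ x.1).symm rfl
    · exact Prod.ext (hdis₂ x.1).symm rfl
  · rintro (x | x) (y | y)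
    · exact Sum.liftRel_inl_inl.trans hi₁.eq_iff.symm
    · exact iff_of_false Sum.not_liftRel_inl_inr (hne _ _)
    · exact iff_of_false Sum.not_liftRel_inr_inl (hne _ _).symm
    · exact Sum.liftRel_inr_inr.trans hi₂.eq_iff.symm

/-- The pre-SYK graph obtained by gluing along two fermionic lines. -/
noncomputable def gluePreGraph (G₁ G₂ : PreGraph q) (d₁ : G₁.V × Fin q) (d₂ : G₂.V × Fin q) :
    PreGraph q where
  V := G₁.V ⊕ G₂.V
  ferm := Function.Involutive.toPerm
    (fun d => (Equiv.sumProdDistrib _ _ _).symm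
      ((G₁.darts.glue G₂.darts d₁ d₂).ferm (Equiv.sumProdDistrib _ _ _ d)))
    (fun d => (Equiv.symm_apply_eq _).2 ((congrArg (G₁.darts.glue G₂.darts d₁ d₂).ferm
      (Equiv.apply_symm_apply _ _)).trans ((G₁.darts.glue G₂.darts d₁ d₂).ferm_invol _)))
  dis := Equiv.sumCongr G₁.dis G₂.dis
  ferm_invol d := Function.Involutive.toPerm_involutive _ d
  ferm_fpf d h := (G₁.darts.glue G₂.darts d₁ d₂).ferm_fpf (Equiv.sumProdDistrib _ _ _ d)
    ((Equiv.symm_apply_eq _).1 h)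
  dis_invol v := by cases v <;> simp [PreGraph.dis_invol]
  dis_fpf v := by cases v <;> simp [PreGraph.dis_fpf]

/-- The dart system of a gluing of pre-SYK graphs. -/
noncomputable def gluePreGraphIso (G₁ G₂ : PreGraph q) (d₁ : G₁.V × Fin q) (d₂ : G₂.V × Fin q) :
    Iso (G₁.darts.glue G₂.darts d₁ d₂) (gluePreGraph G₁ G₂ d₁ d₂).darts where
  toEquiv := (Equiv.sumProdDistrib _ _ _).symm
  map_ferm d := congrArg (fun x => (Equiv.sumProdDistrib _ _ _).symm
    ((G₁.darts.glue G₂.darts d₁ d₂).ferm x)) ((Equiv.sumProdDistrib _ _ _).apply_symm_apply d).symm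
  map_dis d := by rcases d with x | y <;> rfl
  map_sim d d' := by
    rcases d with x | x <;> rcases d' with y | y
    · exact Sum.liftRel_inl_inl.trans Sum.inl_injective.eq_iff.symm
    · exact iff_of_false Sum.not_liftRel_inl_inr Sum.inl_ne_inr
    · exact iff_of_false Sum.not_liftRel_inr_inl Sum.inr_ne_inl
    · exact Sum.liftRel_inr_inr.trans Sum.inr_injective.eq_iff.symm

theorem Graph.exists_isStarGluing (hq : 0 < q) {G₁ G₂ : Graph q} (h₁ : G₁.darts.Bridgeless)
    (h₂ : G₂.darts.Bridgeless) (d₁ : G₁.V × Fin q) (d₂ : G₂.V × Fin q) :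
    ∃ G : Graph q, IsStarGluing G₁ G₂ G d₁ d₂ := by
  have hferm₁ : ∀ x, (gluePreGraph G₁.toPreGraph G₂.toPreGraph d₁ d₂).ferm (dartMap .inl x) =
      (Equiv.sumProdDistrib _ _ _).symm (glueFerm G₁.ferm G₂.ferm d₁ d₂ (.inl x)) := fun _ => rfl
  have hferm₂ : ∀ x, (gluePreGraph G₁.toPreGraph G₂.toPreGraph d₁ d₂).ferm (dartMap .inr x) =
      (Equiv.sumProdDistrib _ _ _).symm (glueFerm G₁.ferm G₂.ferm d₁ d₂ (.inr x)) := fun _ => rfl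
  refine ⟨⟨gluePreGraph G₁.toPreGraph G₂.toPreGraph d₁ d₂, PreGraph.conn0_of_connected hq
    ((h₁.glue h₂ d₁ d₂).of_iso (gluePreGraphIso _ _ _ _)).connected⟩, .inl, .inr,
    Sum.inl_injective, Sum.inr_injective, fun _ _ => Sum.inl_ne_inr, ?_, fun _ => rfl, fun _ => rfl,
    (hferm₁ _).trans ?_, (hferm₁ _).trans ?_, fun x h h' => (hferm₁ x).trans ?_,
    fun x h h' => (hferm₂ x).trans ?_⟩
  · rintro (v | v)
    · exact .inl ⟨v, rfl⟩
    · exact .inr ⟨v, rfl⟩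
  · rw [show glueFerm G₁.ferm G₂.ferm d₁ d₂ (.inl d₁) = .inr d₂ by simp [glueFerm]]
    rfl
  · rw [show glueFerm G₁.ferm G₂.ferm d₁ d₂ (.inl (G₁.ferm d₁)) = .inr (G₂.ferm d₂) by
      simp [glueFerm, G₁.ferm_fpf]]
    rfl
  · rw [show glueFerm G₁.ferm G₂.ferm d₁ d₂ (.inl x) = .inl (G₁.ferm x) by
      simp [glueFerm, h, h']]
    rfl
  · rw [show glueFerm G₁.ferm G₂.ferm d₁ d₂ (.inr x) = .inr (G₂.ferm x) by
      simp [glueFerm, h, h']]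
    rfl

theorem Graph.MelonicMove.exists_isStarGluing (hq : 2 ≤ q) {G G' : Graph q} (h : MelonicMove G G') :
    ∃ d, IsStarGluing G (minGraph hq) G' d (false, ⟨0, by lia⟩) := by
  obtain ⟨x, y, ι, d, hι, hxy, hrange, hdis, hdis', hx, hy, hk, hrest⟩ := h
  have hrange' : ∀ b v, ι v ≠ cond b y x := fun b v h => by
    refine (hrange (cond b y x)).2 ?_ ⟨v, h⟩
    cases b <;> simp
  refine ⟨d, ι, fun b : Bool => cond b y x, hι, ?_, fun v b => hrange' b v, fun v => ?_, hdis', ?_,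
    hx, ?_, hrest, ?_⟩
  · rintro (_ | _) (_ | _) h
    · rfl
    · exact absurd h hxy
    · exact absurd h.symm hxy
    · rfl
  · by_contra! hv
    rcases (hrange v).1 (by simpa using hv.1) with rfl | rfl
    · exact hv.2 false rfl
    · exact hv.2 true rfl
  · rintro (_ | _)
    · exact hdis
    · exact (congrArg G'.dis hdis).symm.trans (G'.dis_invol x)
  · rw [← hy, G'.ferm_invol]
    rfl
  · rintro ⟨_ | _, k⟩ h h'
    · exact hk k fun h0 => h (congrArg (Prod.mk false) h0)
    · exact (congrArg G'.ferm (hk k fun h0 => h' (congrArg (Prod.mk true) h0))).symm.trans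
        (G'.ferm_invol _)

theorem Graph.IsStarGluing.melonicMove (hq : 2 ≤ q) {G G' : Graph q} {d : G.V × Fin q}
    (h : IsStarGluing G (minGraph hq) G' d (false, ⟨0, by lia⟩)) : MelonicMove G G' := by
  obtain ⟨ι₁, ι₂, hi₁, hi₂, hne, hcov, hdis₁, hdis₂, hf, hf', hf₁, hf₂⟩ := h
  refine ⟨ι₂ false, ι₂ true, ι₁, d, hi₁, hi₂.ne Bool.false_ne_true, fun v => ⟨fun h => ?_, ?_⟩,
    hdis₂ false, hdis₁, hf, ?_, fun k hk => ?_, hf₁⟩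
  · obtain ⟨b, rfl⟩ := (hcov v).resolve_left h
    cases b
    · exact .inl rfl
    · exact .inr rfl
  · rintro (rfl | rfl) ⟨w, hw⟩
    · exact hne _ _ hw
    · exact hne _ _ hw
  · exact (congrArg G'.ferm hf').symm.trans (G'.ferm_invol _)
  · exact hf₂ (false, k) (fun h => hk (congrArg Prod.snd h))
      (fun h => Bool.false_ne_true (congrArg Prod.fst h))

theorem Graph.IsMelonic.darts_melonic (hq : 2 ≤ q) {G : Graph q} (h : G.IsMelonic) :
    G.darts.Melonic q := by
  obtain ⟨G₀, Gn, h₀, hmoves, hiso⟩ := h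
  obtain ⟨f⟩ := hiso.exists_iso
  refine .iso ?_ f.symm
  clear f hiso
  induction hmoves with
  | refl =>
    obtain ⟨f⟩ := h₀.exists_iso
    exact .iso .min f
  | tail _ hmove ih =>
    obtain ⟨d, hd⟩ := hmove.exists_isStarGluing hq
    obtain ⟨f⟩ := hd.exists_iso
    exact (ih.glue d _).iso f

theorem DartSystem.Melonic.exists_moves (hq : 2 ≤ q) {A : DartSystem} (h : A.Melonic q) :
    ∃ G₀ Gn : Graph q, G₀.IsMin ∧ Relation.ReflTransGen Graph.MelonicMove G₀ Gn ∧
      Nonempty (Iso A Gn.darts) := by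
  induction h with
  | min => exact ⟨minGraph hq, minGraph hq, minGraph_isMin hq, .refl, ⟨Iso.refl _⟩⟩
  | iso _ f ih =>
    obtain ⟨G₀, Gn, h₀, hmoves, ⟨g⟩⟩ := ih
    exact ⟨G₀, Gn, h₀, hmoves, ⟨f.symm.trans g⟩⟩
  | glue hA a b ih =>
    obtain ⟨G₀, Gn, h₀, hmoves, ⟨f⟩⟩ := ih
    obtain ⟨g, hg⟩ := exists_minDarts_iso b (false, ⟨0, by lia⟩)
    obtain ⟨G', hG'⟩ := Graph.exists_isStarGluing (G₂ := minGraph hq) (by lia)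
      ((hA.bridgeless hq).of_iso f) (minDarts_bridgeless hq) (f.toEquiv a) (g.toEquiv b)
    obtain ⟨k⟩ := hG'.exists_iso
    refine ⟨G₀, G', h₀, hmoves.tail ?_, ⟨(glueCongr f g a b).trans k⟩⟩
    rw [hg] at hG'
    exact hG'.melonicMove hq

theorem Graph.isMelonic_iff (hq : 2 ≤ q) {G : Graph q} : G.IsMelonic ↔ G.darts.Melonic q := by
  refine ⟨fun h => h.darts_melonic hq, fun h => ?_⟩
  obtain ⟨G₀, Gn, h₀, hmoves, ⟨f⟩⟩ := h.exists_moves hq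
  exact ⟨G₀, Gn, h₀, hmoves, isomorphic_of_iso (by lia) f⟩

theorem Graph.IsStarGluing.isMelonic (hq : 2 ≤ q) {G₁ G₂ G : Graph q} {d₁ : G₁.V × Fin q}
    {d₂ : G₂.V × Fin q} (h : IsStarGluing G₁ G₂ G d₁ d₂) (h₁ : G₁.IsMelonic) (h₂ : G₂.IsMelonic) :
    G.IsMelonic := by
  rw [isMelonic_iff hq] at *
  obtain ⟨f⟩ := h.exists_iso
  exact (h₁.glue_melonic h₂ d₁ d₂).iso f

theorem Graph.isBarGluing_iff {G₁ G₂ G : Graph q} {d₁ : G₁.V × Fin q} {d₂ : G₂.V × Fin q} :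
    IsBarGluing G₁ G₂ G d₁ d₂ ↔ IsStarGluing G₁ G₂ G d₁ (G₂.ferm d₂) := by
  simp only [IsBarGluing, IsStarGluing, G₂.ferm_invol]
  have h : ∀ P : G₂.V × Fin q → Prop, (∀ d, d ≠ d₂ → d ≠ G₂.ferm d₂ → P d) ↔
      ∀ d, d ≠ G₂.ferm d₂ → d ≠ d₂ → P d := fun P =>
    forall_congr' fun d => ⟨fun h a b => h b a, fun h a b => h b a⟩
  simp only [h]

end

/-- If `G₁`, `G₂` are melonic SYK graphs, `e₁ = {d₁, τ₁ d₁}`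
is a fermionic line of `G₁` and `e₂ = {d₂, τ₂ d₂}` is a fermionic line of
`G₂`, then both gluings `G₁^{(e₁)} ⋆ G₂^{(e₂)}` and `G₁^{(e₁)} ⋆̄ G₂^{(e₂)}`
exist as SYK graphs and are melonic. -/
theorem syk_gluings_of_melonic_are_melonic (q : ℕ) (hq : 2 ≤ q)
    (G₁ G₂ : Graph q) (h₁ : G₁.IsMelonic) (h₂ : G₂.IsMelonic)
    (d₁ : G₁.V × Fin q) (d₂ : G₂.V × Fin q) :
    (∃ G : Graph q, Graph.IsStarGluing G₁ G₂ G d₁ d₂) ∧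
    (∀ G : Graph q, Graph.IsStarGluing G₁ G₂ G d₁ d₂ → G.IsMelonic) ∧
    (∃ G : Graph q, Graph.IsBarGluing G₁ G₂ G d₁ d₂) ∧
    (∀ G : Graph q, Graph.IsBarGluing G₁ G₂ G d₁ d₂ → G.IsMelonic) := by
  have hb₁ := (h₁.darts_melonic hq).bridgeless hq
  have hb₂ := (h₂.darts_melonic hq).bridgeless hq
  simp only [Graph.isBarGluing_iff]
  exact ⟨Graph.exists_isStarGluing (by lia) hb₁ hb₂ d₁ d₂, fun G h => h.isMelonic hq h₁ h₂,
    Graph.exists_isStarGluing (by lia) hb₁ hb₂ d₁ (G₂.ferm d₂), fun G h => h.isMelonic hq h₁ h₂⟩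

end SYK
end

section
/- If G' is obtained from an SYK graph G by a melonic move on a fermionic line of G, then |V(G')| = |V(G)| + 2 and F(G') = F(G) + (q − 1). -/
namespace SYK

variable {q : ℕ}

namespace PreGraph

/-- The faces of `H`. -/
abbrev Face (H : PreGraph q) : Type :=
  MulAction.orbitRel.Quotient H.faceGroup H.Dart

/-- The face through a dart. -/
def face (H : PreGraph q) (d : H.Dart) : H.Face :=
  Quotient.mk _ d

lemma face_ferm (H : PreGraph q) (d : H.Dart) : H.face (H.ferm d) = H.face d :=
  Quotient.sound (s := MulAction.orbitRel H.faceGroup H.Dart)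
    ⟨⟨H.ferm, Subgroup.subset_closure (by simp)⟩, rfl⟩

lemma face_dishat (H : PreGraph q) (d : H.Dart) : H.face (H.dishat d) = H.face d :=
  Quotient.sound (s := MulAction.orbitRel H.faceGroup H.Dart)
    ⟨⟨H.dishat, Subgroup.subset_closure (by simp)⟩, rfl⟩

lemma face_dis (H : PreGraph q) (v : H.V) (m : Fin q) :
    H.face (H.dis v, m) = H.face (v, m) :=
  H.face_dishat (v, m)

/-- A function on darts invariant under both pairings descends to the faces. -/
def faceLift (H : PreGraph q) {β : Type*} (f : H.Dart → β)
    (hferm : ∀ d, f (H.ferm d) = f d) (hdis : ∀ d, f (H.dishat d) = f d) :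
    H.Face → β :=
  Quotient.lift f <| by
    rintro _ b ⟨⟨g, hg⟩, rfl⟩
    change f (g b) = f b
    induction hg using Subgroup.closure_induction generalizing b with
    | mem g hg =>
      rcases hg with rfl | rfl
      · exact hferm b
      · exact hdis b
    | one => rfl
    | mul g₁ g₂ _ _ h₁ h₂ => exact (h₁ (g₂ b)).trans (h₂ b)
    | inv g _ h => simpa using (h (g⁻¹ b)).symm

@[simp]
lemma faceLift_face (H : PreGraph q) {β : Type*} (f : H.Dart → β)
    (hferm : ∀ d, f (H.ferm d) = f d) (hdis : ∀ d, f (H.dishat d) = f d) (d : H.Dart) :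
    H.faceLift f hferm hdis (H.face d) = f d :=
  rfl

lemma face_surjective (H : PreGraph q) : Function.Surjective H.face :=
  Quotient.mk_surjective

end PreGraph

/-- If `G'` is obtained from an SYK graph `G` by a melonic
move on a fermionic line of `G`, then `|V(G')| = |V(G)| + 2` and
`F(G') = F(G) + (q − 1)`. -/
theorem syk_melonic_move_vertices_and_faces (q : ℕ) (hq : 2 ≤ q)
    (G G' : Graph q) (h : G.MelonicMove G') :
    G'.toPreGraph.nV = G.toPreGraph.nV + 2 ∧
      G'.toPreGraph.F = G.toPreGraph.F + (q - 1) := by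
  obtain ⟨x, y, ι, d, hι, hxy, hnew, hdx, hdι, hfd, hfy, hfx, hfι⟩ := h
  have hx : ∀ v, ι v ≠ x := fun v hv => (hnew x).2 (Or.inl rfl) ⟨v, hv⟩
  have hy : ∀ v, ι v ≠ y := fun v hv => (hnew y).2 (Or.inr rfl) ⟨v, hv⟩
  have hdy : G'.dis y = x := by rw [← hdx, G'.dis_invol]
  set z : Fin q := ⟨0, d.2.pos⟩
  have hfx0 : G'.ferm (x, z) = dartMap ι d := by rw [← hfd, G'.ferm_invol]
  have hfτ : G'.ferm (dartMap ι (G.ferm d)) = (y, z) := by rw [← hfy, G'.ferm_invol]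
  have hfyk : ∀ k, k ≠ z → G'.ferm (y, k) = (x, k) := fun k hk => by
    rw [← hfx k hk, G'.ferm_invol]
  have hbij : Function.Bijective (Sum.elim ι (fun b : Bool => cond b x y)) := by
    refine ⟨hι.sumElim ?_ ?_, fun v' => ?_⟩
    · rintro (_ | _) (_ | _) h <;> simp_all
    · rintro v (_ | _)
      · exact hy v
      · exact hx v
    · by_cases hv : ∃ v, ι v = v'
      · obtain ⟨v, rfl⟩ := hv
        exact ⟨.inl v, rfl⟩
      · rcases (hnew v').1 hv with rfl | rfl
        · exact ⟨.inr true, rfl⟩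
        · exact ⟨.inr false, rfl⟩
  let e := Equiv.ofBijective _ hbij
  have heι : ∀ v, e.symm (ι v) = .inl v := fun v => e.symm_apply_apply (.inl v)
  have hex : e.symm x = .inr true := e.symm_apply_apply (.inr true)
  have hey : e.symm y = .inr false := e.symm_apply_apply (.inr false)
  have hcases : ∀ p : G'.Dart → Prop, (∀ c, p (dartMap ι c)) → (∀ k, p (x, k)) →
      (∀ k, p (y, k)) → ∀ c, p c := by
    rintro p h₁ h₂ h₃ ⟨v', k⟩
    obtain ⟨v | (_ | _), rfl⟩ := hbij.2 v'
    · exact h₁ (v, k)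
    · exact h₃ k
    · exact h₂ k
  refine ⟨?_, ?_⟩
  · have := Nat.card_congr e
    rw [Nat.card_sum] at this
    simpa [PreGraph.nV] using this.symm
  let g : Fin q → G.Face ⊕ {k : Fin q // k ≠ z} :=
    fun k => if hk : k = z then .inl (G.face d) else .inr ⟨k, hk⟩
  let f : G'.Dart → G.Face ⊕ {k : Fin q // k ≠ z} :=
    fun c => Sum.elim (fun v => .inl (G.face (v, c.2))) (fun _ => g c.2) (e.symm c.1)
  have fι : ∀ c, f (dartMap ι c) = .inl (G.face c) := fun c => by simp [f, dartMap, heι]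
  have fx : ∀ k, f (x, k) = g k := fun k => by simp [f, hex]
  have fy : ∀ k, f (y, k) = g k := fun k => by simp [f, hey]
  have gz : g z = .inl (G.face d) := by simp [g]
  have hferm : ∀ c, f (G'.ferm c) = f c := by
    refine hcases _ (fun c => ?_) (fun k => ?_) (fun k => ?_)
    · by_cases h₁ : c = d
      · rw [h₁, hfd, fι, fx, gz]
      · by_cases h₂ : c = G.ferm d
        · rw [h₂, hfτ, fι, fy, gz, G.face_ferm]
        · rw [hfι c h₁ h₂, fι, fι, G.face_ferm]
    · by_cases hk : k = z
      · rw [hk, hfx0, fι, fx, gz]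
      · rw [hfx k hk, fx, fy]
    · by_cases hk : k = z
      · rw [hk, hfy, fι, fy, gz, G.face_ferm]
      · rw [hfyk k hk, fx, fy]
  have hdis : ∀ c, f (G'.dishat c) = f c := by
    refine hcases _ (fun c => ?_) (fun k => ?_) (fun k => ?_)
    · have : G'.dishat (dartMap ι c) = dartMap ι (G.dishat c) :=
        Prod.ext (hdι c.1) rfl
      rw [this, fι, fι, G.face_dishat]
    · change f (G'.dis x, k) = _
      rw [hdx, fx, fy]
    · change f (G'.dis y, k) = _
      rw [hdy, fx, fy]
  have hxz : G'.face (x, z) = G'.face (dartMap ι d) := by rw [← hfd, G'.face_ferm]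
  have hyx : ∀ k, G'.face (y, k) = G'.face (x, k) := fun k => by rw [← hdx, G'.face_dis]
  have hd : G'.face (dartMap ι (G.ferm d)) = G'.face (dartMap ι d) := by
    rw [← hfy, G'.face_ferm, hyx, hxz]
  have kferm : ∀ c, G'.face (dartMap ι (G.ferm c)) = G'.face (dartMap ι c) := by
    intro c
    by_cases h₁ : c = d
    · rw [h₁, hd]
    · by_cases h₂ : c = G.ferm d
      · rw [h₂, G.ferm_invol, hd]
      · rw [← hfι c h₁ h₂, G'.face_ferm]
  have kdis : ∀ c, G'.face (dartMap ι (G.dishat c)) = G'.face (dartMap ι c) := fun c => by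
    rw [← G'.face_dishat (dartMap ι c)]
    exact congrArg G'.face (Prod.ext (hdι c.1).symm rfl)
  let E : G'.Face ≃ G.Face ⊕ {k : Fin q // k ≠ z} :=
    { toFun := G'.faceLift f hferm hdis
      invFun := Sum.elim (G.faceLift (fun c => G'.face (dartMap ι c)) kferm kdis)
        (fun k => G'.face (x, k))
      left_inv := by
        intro F
        obtain ⟨c, rfl⟩ := G'.face_surjective F
        rw [PreGraph.faceLift_face]
        revert c
        have hg : ∀ k, Sum.elim (G.faceLift (fun c => G'.face (dartMap ι c)) kferm kdis)
            (fun k : {k : Fin q // k ≠ z} => G'.face (x, k)) (g k) = G'.face (x, k) := by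
          intro k
          by_cases hk : k = z
          · rw [hk, gz, hxz]
            rfl
          · simp [g, hk]
        refine hcases _ (fun c => ?_) (fun k => ?_) (fun k => ?_)
        · rw [fι]
          rfl
        · rw [fx, hg]
        · rw [fy, hg, hyx]
      right_inv := by
        rintro (F | ⟨k, hk⟩)
        · obtain ⟨c, rfl⟩ := G.face_surjective F
          exact fι c
        · exact (fx k).trans (dif_neg hk) }
  have := Nat.card_congr E
  rw [Nat.card_sum] at this
  simpa [PreGraph.F] using this

end SYK
end

section
/- Every melonic SYK graph G satisfies δ(G) = 1. -/
namespace SYK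

variable {q : ℕ}

/-- Two darts are consecutive on a face: one is the image of the other under `τ` or `π̂`. -/
def PreGraph.FaceStep (H : PreGraph q) (d e : H.Dart) : Prop :=
  e = H.ferm d ∨ e = H.dishat d

lemma PreGraph.quot_mk_ferm (H : PreGraph q) (d : H.Dart) :
    Quot.mk H.FaceStep (H.ferm d) = Quot.mk H.FaceStep d :=
  (Quot.sound (r := H.FaceStep) (Or.inl rfl)).symm

lemma PreGraph.quot_mk_dishat (H : PreGraph q) (d : H.Dart) :
    Quot.mk H.FaceStep (H.dishat d) = Quot.mk H.FaceStep d :=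
  (Quot.sound (r := H.FaceStep) (Or.inr rfl)).symm

lemma PreGraph.quot_mk_smul (H : PreGraph q) (g : H.faceGroup) (d : H.Dart) :
    Quot.mk H.FaceStep (g • d) = Quot.mk H.FaceStep d := by
  obtain ⟨g, hg⟩ := g
  change Quot.mk H.FaceStep (g d) = Quot.mk H.FaceStep d
  induction hg using Subgroup.closure_induction generalizing d with
  | mem f hf =>
    rcases hf with rfl | hf
    · exact H.quot_mk_ferm d
    · rw [Set.mem_singleton_iff] at hf
      subst hf
      exact H.quot_mk_dishat d
  | one => rfl
  | mul f g _ _ ihf ihg => rw [Equiv.Perm.mul_apply, ihf, ihg]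
  | inv f _ ih =>
    have := ih (f⁻¹ d)
    simpa using this.symm

lemma PreGraph.F_eq_card_quot (H : PreGraph q) : H.F = Nat.card (Quot H.FaceStep) := by
  refine Nat.card_congr ⟨Quotient.lift (Quot.mk H.FaceStep) ?_,
    Quot.lift (Quotient.mk _) ?_, ?_, ?_⟩
  · rintro a b ⟨g, rfl⟩
    exact H.quot_mk_smul g b
  · rintro a b h
    refine (Quotient.sound (s := MulAction.orbitRel H.faceGroup H.Dart) ?_).symm
    rcases h with rfl | rfl
    · exact ⟨⟨H.ferm, Subgroup.subset_closure (by simp)⟩, rfl⟩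
    · exact ⟨⟨H.dishat, Subgroup.subset_closure (by simp)⟩, rfl⟩
  · rintro ⟨d⟩
    rfl
  · rintro ⟨d⟩
    rfl

lemma Graph.IsMin.F_eq {G : Graph q} (h : G.IsMin) : G.F = q := by
  obtain ⟨a, b, -, hV, hdis, hferm⟩ := h
  have hferm' (m : Fin q) : G.ferm (b, m) = (a, m) := by rw [← hferm, G.ferm_invol]
  rw [PreGraph.F_eq_card_quot]
  conv_rhs => rw [← Nat.card_fin q]
  refine Nat.card_congr ⟨Quot.lift Prod.snd ?_, fun m => Quot.mk _ (a, m), ?_, fun _ => rfl⟩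
  · rintro ⟨v, m⟩ e (rfl | rfl)
    · rcases hV v with rfl | rfl
      · rw [hferm]
      · rw [hferm']
    · rfl
  · rintro ⟨v, m⟩
    rcases hV v with rfl | rfl
    · rfl
    · exact Quot.sound (Or.inl (hferm m).symm)

lemma Graph.IsMin.nV_eq {G : Graph q} (h : G.IsMin) : G.nV = 2 := by
  obtain ⟨a, b, hab, hV, -⟩ := h
  rw [PreGraph.nV, Nat.card_eq_two_iff]
  exact ⟨a, b, hab, by ext v; simpa using hV v⟩

lemma Graph.IsMin.delta_eq_one {G : Graph q} (h : G.IsMin) : G.delta = 1 := by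
  simp [PreGraph.delta, h.F_eq, h.nV_eq]

lemma Graph.MelonicMove.nV_eq {G G' : Graph q} (h : G.MelonicMove G') :
    G'.nV = G.nV + 2 := by
  obtain ⟨x, y, ι, d, hι, hxy, hV, -⟩ := h
  have hx (v) : ι v ≠ x := fun hv => (hV x).2 (Or.inl rfl) ⟨v, hv⟩
  have hy (v) : ι v ≠ y := fun hv => (hV y).2 (Or.inr rfl) ⟨v, hv⟩
  have hbij : Function.Bijective (Sum.elim ι (fun b : Bool => if b then x else y)) := by
    constructor
    · refine hι.sumElim ?_ ?_
      · rintro (_ | _) (_ | _) <;> simp [hxy, hxy.symm]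
      · rintro v (_ | _) <;> simp [hx, hy]
    · intro v'
      by_cases h : ∃ v, ι v = v'
      · obtain ⟨v, rfl⟩ := h
        exact ⟨Sum.inl v, rfl⟩
      · rcases (hV v').1 h with rfl | rfl
        · exact ⟨Sum.inr true, rfl⟩
        · exact ⟨Sum.inr false, rfl⟩
  rw [PreGraph.nV, ← Nat.card_eq_of_bijective _ hbij, Nat.card_sum, PreGraph.nV]
  simp

open Classical in
lemma Graph.MelonicMove.F_eq {G G' : Graph q} (h : G.MelonicMove G') :
    G'.F = G.F + (q - 1) := by
  obtain ⟨x, y, ι, d, hι, hxy, hV, hdis, hdisι, hfd, hfy, hfk, hfι⟩ := h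
  have hx (v) : ι v ≠ x := fun hv => (hV x).2 (Or.inl rfl) ⟨v, hv⟩
  have hy (v) : ι v ≠ y := fun hv => (hV y).2 (Or.inr rfl) ⟨v, hv⟩
  set z : Fin q := ⟨0, d.2.pos⟩
  have hdis' : G'.dis y = x := by rw [← hdis, G'.dis_invol]
  have hfx : G'.ferm (x, z) = dartMap ι d := by rw [← hfd, G'.ferm_invol]
  have hfτ : G'.ferm (dartMap ι (G.ferm d)) = (y, z) := by rw [← hfy, G'.ferm_invol]
  have hfk' (k : Fin q) (hk : k ≠ z) : G'.ferm (y, k) = (x, k) := by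
    rw [← hfk k hk, G'.ferm_invol]
  have hd := G.quot_mk_ferm d
  have hmkxy (k) : Quot.mk G'.FaceStep (x, k) = Quot.mk G'.FaceStep (y, k) :=
    Quot.sound (Or.inr (by simp [PreGraph.dishat, hdis]))
  have hmkd : Quot.mk G'.FaceStep (dartMap ι d) = Quot.mk G'.FaceStep (x, z) :=
    Quot.sound (Or.inl hfd.symm)
  have hmkτ : Quot.mk G'.FaceStep (dartMap ι (G.ferm d)) = Quot.mk G'.FaceStep (y, z) :=
    Quot.sound (Or.inl hfτ.symm)
  let new (k : Fin q) : Quot G.FaceStep ⊕ {k : Fin q // k ≠ z} :=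
    if hk : k = z then Sum.inl (Quot.mk _ d) else Sum.inr ⟨k, hk⟩
  let r (d' : G'.Dart) : Quot G.FaceStep ⊕ {k : Fin q // k ≠ z} :=
    if hv : ∃ v, ι v = d'.1 then Sum.inl (Quot.mk _ (hv.choose, d'.2)) else new d'.2
  have hrι (e : G.Dart) : r (dartMap ι e) = Sum.inl (Quot.mk _ e) := by
    have hv : ∃ v, ι v = (dartMap ι e).1 := ⟨e.1, rfl⟩
    have hc : hv.choose = e.1 := hι hv.choose_spec
    simp only [r, dif_pos hv, hc]
    rfl
  have hrx (k) : r (x, k) = new k := by simp [r, hx]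
  have hry (k) : r (y, k) = new k := by simp [r, hy]
  have hnew : new z = Sum.inl (Quot.mk _ d) := by simp [new]
  have hcases (d' : G'.Dart) :
      (∃ e, d' = dartMap ι e) ∨ (∃ k, d' = (x, k)) ∨ ∃ k, d' = (y, k) := by
    obtain ⟨v', k⟩ := d'
    by_cases h : ∃ v, ι v = v'
    · obtain ⟨v, rfl⟩ := h
      exact Or.inl ⟨(v, k), rfl⟩
    · rcases (hV v').1 h with rfl | rfl
      · exact Or.inr (Or.inl ⟨k, rfl⟩)
      · exact Or.inr (Or.inr ⟨k, rfl⟩)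
  have hrstep (a b : G'.Dart) (hab : G'.FaceStep a b) : r a = r b := by
    rcases hab with rfl | rfl
    · rcases hcases a with ⟨e, rfl⟩ | ⟨k, rfl⟩ | ⟨k, rfl⟩
      · by_cases h₁ : e = d
        · rw [h₁, hfd, hrι, hrx, hnew]
        by_cases h₂ : e = G.ferm d
        · rw [h₂, hfτ, hrι, hry, hnew, hd]
        rw [hfι e h₁ h₂, hrι, hrι]
        exact congrArg Sum.inl (Quot.sound (Or.inl rfl))
      · by_cases hk : k = z
        · rw [hk, hfx, hrx, hrι, hnew]
        · rw [hfk k hk, hrx, hry]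
      · by_cases hk : k = z
        · rw [hk, hfy, hry, hrι, hnew, hd]
        · rw [hfk' k hk, hrx, hry]
    · rcases hcases a with ⟨e, rfl⟩ | ⟨k, rfl⟩ | ⟨k, rfl⟩
      · have : G'.dishat (dartMap ι e) = dartMap ι (G.dishat e) := by
          simp [PreGraph.dishat, dartMap, hdisι, Prod.map]
        rw [this, hrι, hrι]
        exact congrArg Sum.inl (Quot.sound (Or.inr rfl))
      · have : G'.dishat (x, k) = (y, k) := by simp [PreGraph.dishat, hdis]
        rw [this, hrx, hry]
      · have : G'.dishat (y, k) = (x, k) := by simp [PreGraph.dishat, hdis']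
        rw [this, hrx, hry]
  have hιstep (a b : G.Dart) (hab : G.FaceStep a b) :
      Quot.mk G'.FaceStep (dartMap ι a) = Quot.mk G'.FaceStep (dartMap ι b) := by
    rcases hab with rfl | rfl
    · by_cases h₁ : a = d
      · rw [h₁, hmkd, hmkτ, hmkxy]
      by_cases h₂ : a = G.ferm d
      · rw [h₂, G.ferm_invol, hmkd, hmkτ, hmkxy]
      exact Quot.sound (Or.inl (hfι a h₁ h₂).symm)
    · exact Quot.sound (Or.inr (by simp [PreGraph.dishat, dartMap, hdisι, Prod.map]))
  have hcard : Nat.card (Quot G'.FaceStep) =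
      Nat.card (Quot G.FaceStep ⊕ {k : Fin q // k ≠ z}) := by
    refine Nat.card_congr ⟨Quot.lift r hrstep,
      Sum.elim (Quot.lift (fun e => Quot.mk _ (dartMap ι e)) hιstep)
        (fun k => Quot.mk _ (x, k.1)), ?_, ?_⟩
    · have hinv (k) : Sum.elim (Quot.lift (fun e => Quot.mk G'.FaceStep (dartMap ι e)) hιstep)
          (fun k => Quot.mk _ (x, k.1)) (new k) = Quot.mk _ (x, k) := by
        by_cases hk : k = z
        · rw [hk, hnew]
          exact hmkd
        · simp [new, hk]
      rintro ⟨a⟩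
      change Sum.elim _ _ (r a) = Quot.mk _ a
      rcases hcases a with ⟨e, rfl⟩ | ⟨k, rfl⟩ | ⟨k, rfl⟩
      · rw [hrι]
        rfl
      · rw [hrx, hinv]
      · rw [hry, hinv, hmkxy]
    · rintro (⟨⟨e⟩⟩ | ⟨k, hk⟩)
      · exact hrι e
      · change r (x, k) = _
        rw [hrx]
        simp [new, hk]
  have : Finite (Quot G.FaceStep) := Finite.of_surjective _ Quot.mk_surjective
  rw [PreGraph.F_eq_card_quot, PreGraph.F_eq_card_quot, hcard, Nat.card_sum]
  simp

lemma Graph.MelonicMove.delta_eq (hq : 1 ≤ q) {G G' : Graph q} (h : G.MelonicMove G') :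
    G'.delta = G.delta := by
  rw [PreGraph.delta, PreGraph.delta, h.F_eq, h.nV_eq, Nat.add_div_right _ two_pos]
  push_cast [hq]
  ring

lemma Graph.Isomorphic.F_eq {G G' : Graph q} (h : G.Isomorphic G') : G.F = G'.F := by
  obtain ⟨φ, hferm, hdis, -⟩ := h
  rw [PreGraph.F_eq_card_quot, PreGraph.F_eq_card_quot]
  refine Nat.card_congr (Quot.congr φ fun a b => ?_)
  rw [PreGraph.FaceStep, PreGraph.FaceStep, ← hferm, ← hdis, φ.apply_eq_iff_eq,
    φ.apply_eq_iff_eq]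

lemma Graph.Isomorphic.nV_eq (hq : 1 ≤ q) {G G' : Graph q} (h : G.Isomorphic G') :
    G.nV = G'.nV := by
  obtain ⟨φ, -⟩ := h
  have := Nat.card_congr φ
  rw [Nat.card_prod, Nat.card_prod, Nat.card_fin] at this
  exact Nat.eq_of_mul_eq_mul_right hq this

/-- Every melonic SYK graph `G` satisfies `δ(G) = 1`. -/
theorem syk_melonic_delta_eq_one (q : ℕ) (hq : 2 ≤ q) (G : Graph q)
    (h : G.IsMelonic) :
    G.toPreGraph.delta = 1 := by
  obtain ⟨G₀, Gn, hmin, hmoves, hiso⟩ := h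
  have hq' : 1 ≤ q := by omega
  have hδ : Gn.delta = 1 := by
    clear hiso
    induction hmoves with
    | refl => exact hmin.delta_eq_one
    | tail _ hmove ih => rw [hmove.delta_eq hq', ih]
  rw [← hδ, PreGraph.delta, PreGraph.delta, hiso.F_eq, hiso.nV_eq hq']

end SYK
end

section
/- Let q ≥ 2, let G be an SYK graph and let e₁ ≠ e₂ be fermionic lines of G belonging to a common face such that {e₁, e₂} is not a 2-cut of G₀. Then there exists an SYK graph G' with the same vertex set and the same disorder pairing as G, whose fermionic pairing agrees with that of G on all darts not belonging to e₁ or e₂, such that F(G') = F(G) + 1. -/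
namespace SYK

variable {q : ℕ}

section RegluingInvolutions

variable {X : Type*}

/-- An equivalence relation compatible with two permutations contains the orbit relation of the
subgroup they generate. -/
theorem rel_of_mem_orbit_closure_pair {t p : Equiv.Perm X} (s : Setoid X)
    (ht : ∀ x, s (t x) x) (hp : ∀ x, s (p x) x) {x y : X}
    (h : x ∈ MulAction.orbit (Subgroup.closure {t, p}) y) : s x y := by
  obtain ⟨⟨g, hg⟩, rfl⟩ := h
  change s (g y) y
  induction hg using Subgroup.closure_induction generalizing y with
  | mem g hg =>
    rcases hg with rfl | rfl
    exacts [ht y, hp y]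
  | one => exact s.refl y
  | mul a b _ _ iha ihb => exact s.trans (iha (y := b y)) ihb
  | inv a _ iha => simpa using s.symm (iha (y := a⁻¹ y))

theorem left_mem_orbit_closure_pair (t p : Equiv.Perm X) (x : X) :
    MulAction.orbitRel (Subgroup.closure {t, p}) X (t x) x :=
  ⟨⟨t, Subgroup.subset_closure (by simp)⟩, rfl⟩

theorem right_mem_orbit_closure_pair (t p : Equiv.Perm X) (x : X) :
    MulAction.orbitRel (Subgroup.closure {t, p}) X (p x) x :=
  ⟨⟨p, Subgroup.subset_closure (by simp)⟩, rfl⟩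

/-- Identifying two distinct classes of an equivalence relation lowers the number of classes
by one. -/
theorem card_quotient_eq_add_one_of_merge [Finite X] (s s' : Setoid X) (a b : X)
    (hle : ∀ x y, s' x y → s x y) (hab : s a b) (hab' : ¬ s' a b)
    (hmerge : ∀ x, s x a → s' x a ∨ s' x b)
    (hother : ∀ x y, s x y → ¬ s x a → s' x y) :
    Nat.card (Quotient s') = Nat.card (Quotient s) + 1 := by
  classical
  have hne : (Quotient.mk s' a) ≠ Quotient.mk s' b := fun h => hab' (Quotient.exact h)
  let φ : {c : Quotient s' // c ≠ Quotient.mk s' b} → Quotient s :=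
    fun c => Quotient.map' id hle c.1
  have hφ : Function.Bijective φ := by
    constructor
    · rintro ⟨c, hc⟩ ⟨d, hd⟩ h
      induction c using Quotient.inductionOn with | _ x
      induction d using Quotient.inductionOn with | _ y
      have hxy : s x y := Quotient.exact h
      apply Subtype.ext
      apply Quotient.sound
      by_cases hx : s x a
      · have hx' := (hmerge x hx).resolve_right fun h => hc (Quotient.sound h)
        have hy' := (hmerge y (s.trans (s.symm hxy) hx)).resolve_right
          fun h => hd (Quotient.sound h)
        exact s'.trans hx' (s'.symm hy')
      · exact hother x y hxy hx
    · intro c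
      induction c using Quotient.inductionOn with | _ x
      by_cases hx : s' x b
      · exact ⟨⟨Quotient.mk s' a, hne⟩,
          Quotient.sound (s.trans hab (s.symm (hle _ _ hx)))⟩
      · exact ⟨⟨Quotient.mk s' x, fun h => hx (Quotient.exact h)⟩, rfl⟩
  rw [← Nat.card_eq_of_bijective φ hφ, ← Finite.card_option]
  exact Nat.card_congr (Equiv.optionSubtypeNe _).symm

variable {t p : Equiv.Perm X}

/-- A word of odd length in two fixed-point-free involutions has no fixed point. -/
theorem invol_mul_pow_apply_ne (ht : ∀ x, t (t x) = x) (hp : ∀ x, p (p x) = x)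
    (ht' : ∀ x, t x ≠ x) (hp' : ∀ x, p x ≠ x) (n : ℕ) (x : X) :
    t (((p * t) ^ n) x) ≠ x := by
  induction n using Nat.twoStepInduction generalizing x with
  | zero => simpa using ht' x
  | one =>
    intro h
    apply hp' (t x)
    have := congrArg t h
    simpa [ht] using this
  | more n ih _ =>
    intro h
    apply ih ((p * t) x)
    rw [pow_succ', pow_succ, Equiv.Perm.mul_apply, Equiv.Perm.mul_apply] at h
    have := congrArg (p * t) h
    simpa [ht, hp] using this

theorem invol_pow_apply_ne_pow_apply (ht : ∀ x, t (t x) = x) (hp : ∀ x, p (p x) = x)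
    (ht' : ∀ x, t x ≠ x) (hp' : ∀ x, p x ≠ x) (i j : ℕ) (x : X) :
    t (((p * t) ^ i) x) ≠ ((p * t) ^ j) x := by
  induction j generalizing i with
  | zero => simpa using invol_mul_pow_apply_ne ht hp ht' hp' i x
  | succ j ih =>
    intro h
    apply ih (i + 1)
    rw [pow_succ', Equiv.Perm.mul_apply] at h ⊢
    have h' := congrArg (fun z => t (p z)) h
    simpa [ht, hp] using h'

/-- The orbit of `x` under two involutions is the union of the `p * t`-orbit of `x` and its image
under `t`. -/
theorem exists_pow_of_mem_orbit [Finite X] (ht : ∀ x, t (t x) = x) (hp : ∀ x, p (p x) = x)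
    {x y : X} (h : y ∈ MulAction.orbit (Subgroup.closure {t, p}) x) :
    ∃ n : ℕ, y = ((p * t) ^ n) x ∨ y = t (((p * t) ^ n) x) := by
  let P : X → Prop := fun y => ∃ n : ℕ, y = ((p * t) ^ n) x ∨ y = t (((p * t) ^ n) x)
  have hPt : ∀ y, P y → P (t y) := by
    rintro _ ⟨n, rfl | rfl⟩
    · exact ⟨n, Or.inr rfl⟩
    · exact ⟨n, Or.inl (ht _)⟩
  have hPp : ∀ y, P y → P (p y) := by
    rintro _ ⟨n, rfl | rfl⟩
    · have hpos : 0 < orderOf (p * t) := orderOf_pos _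
      refine ⟨n + (orderOf (p * t) - 1), Or.inr ?_⟩
      have h1 : (p * t) ^ n = (p * t) * (p * t) ^ (n + (orderOf (p * t) - 1)) := by
        rw [← pow_succ', show n + (orderOf (p * t) - 1) + 1 = n + orderOf (p * t) by omega,
          pow_add, pow_orderOf_eq_one, mul_one]
      conv_lhs => rw [h1]
      simp [hp]
    · exact ⟨n + 1, Or.inl (by rw [pow_succ']; rfl)⟩
  let s : Setoid X := Setoid.comap P ⊥
  have hs : s y x := by
    refine rel_of_mem_orbit_closure_pair s (fun z => ?_) (fun z => ?_) h
    · exact propext ⟨fun h => by simpa [ht] using hPt _ h, hPt z⟩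
    · exact propext ⟨fun h => by simpa [hp] using hPp _ h, hPp z⟩
  have hyx : P y = P x := hs
  exact hyx.mpr ⟨0, Or.inl rfl⟩

variable [DecidableEq X]

/-- The pairing `t` with `{a, t a}` and `{b, t b}` replaced by `{a, t b}` and `{b, t a}`. -/
def reglue (t : Equiv.Perm X) (a b : X) : Equiv.Perm X :=
  t * (Equiv.swap a b * Equiv.swap (t a) (t b))

theorem reglue_apply_left {a b : X} (ht' : ∀ x, t x ≠ x) (hab' : a ≠ t b) :
    reglue t a b a = t b := by
  simp [reglue, Equiv.swap_apply_of_ne_of_ne (ht' a).symm hab']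

theorem reglue_apply_right {a b : X} (ht : ∀ x, t (t x) = x) (ht' : ∀ x, t x ≠ x)
    (hab' : a ≠ t b) : reglue t a b b = t a := by
  have h : b ≠ t a := fun h => hab' (by rw [h, ht])
  simp [reglue, Equiv.swap_apply_of_ne_of_ne h (ht' b).symm]

theorem reglue_apply_invol_left {a b : X} (ht : ∀ x, t (t x) = x) (ht' : ∀ x, t x ≠ x)
    (hab' : a ≠ t b) : reglue t a b (t a) = b := by
  simp [reglue, Equiv.swap_apply_of_ne_of_ne hab'.symm (ht' b), ht]

theorem reglue_apply_invol_right {a b : X} (ht : ∀ x, t (t x) = x) (ht' : ∀ x, t x ≠ x)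
    (hab' : a ≠ t b) : reglue t a b (t b) = a := by
  have h : t a ≠ b := fun h => hab' (by rw [← h, ht])
  simp [reglue, Equiv.swap_apply_of_ne_of_ne (ht' a) h, ht]

theorem reglue_apply_of_ne {a b x : X} (hxa : x ≠ a) (hxb : x ≠ b)
    (hxta : x ≠ t a) (hxtb : x ≠ t b) : reglue t a b x = t x := by
  simp [reglue, Equiv.swap_apply_of_ne_of_ne hxa hxb, Equiv.swap_apply_of_ne_of_ne hxta hxtb]

theorem forall_reglue {a b : X} {Q : X → X → Prop} (ht : ∀ x, t (t x) = x)
    (ht' : ∀ x, t x ≠ x) (hab' : a ≠ t b) (h₁ : Q (t b) a) (h₂ : Q (t a) b) (h₃ : Q b (t a))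
    (h₄ : Q a (t b)) (h₅ : ∀ x, x ≠ a → x ≠ b → x ≠ t a → x ≠ t b → Q (t x) x) (x : X) :
    Q (reglue t a b x) x := by
  by_cases hxa : x = a
  · rwa [hxa, reglue_apply_left ht' hab']
  by_cases hxb : x = b
  · rwa [hxb, reglue_apply_right ht ht' hab']
  by_cases hxta : x = t a
  · rwa [hxta, reglue_apply_invol_left ht ht' hab']
  by_cases hxtb : x = t b
  · rwa [hxtb, reglue_apply_invol_right ht ht' hab']
  rw [reglue_apply_of_ne hxa hxb hxta hxtb]
  exact h₅ x hxa hxb hxta hxtb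

theorem reglue_reglue {a b : X} (ht : ∀ x, t (t x) = x) (ht' : ∀ x, t x ≠ x)
    (hab' : a ≠ t b) (x : X) : reglue t a b (reglue t a b x) = x := by
  refine forall_reglue (Q := fun y x => reglue t a b y = x) ht ht' hab'
    (reglue_apply_invol_right ht ht' hab') (reglue_apply_invol_left ht ht' hab')
    (reglue_apply_right ht ht' hab') (reglue_apply_left ht' hab') (fun x h₁ h₂ h₃ h₄ => ?_) x
  have hinv : ∀ {z}, t x = z → x = t z := fun h => by rw [← h, ht]
  rw [reglue_apply_of_ne (fun h => h₃ (hinv h))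
    (fun h => h₄ (hinv h)) (fun h => h₁ (t.injective h)) (fun h => h₂ (t.injective h)), ht]

theorem reglue_apply_ne {a b : X} (ht : ∀ x, t (t x) = x) (ht' : ∀ x, t x ≠ x)
    (hab' : a ≠ t b) (x : X) : reglue t a b x ≠ x :=
  forall_reglue (Q := fun y x => y ≠ x) ht ht' hab' hab'.symm
    (fun h => hab' (by rw [← h, ht])) (fun h => hab' (by rw [h, ht])) hab'
    (fun x _ _ _ _ => ht' x) x

/-- After regluing, the two darts lie in distinct orbits when they have the same orientation. -/
theorem not_mem_orbit_reglue (ht : ∀ x, t (t x) = x) (hp : ∀ x, p (p x) = x)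
    (ht' : ∀ x, t x ≠ x) (hp' : ∀ x, p x ≠ x) {a b : X} (hab : a ≠ b)
    (h : ∃ n : ℕ, b = ((p * t) ^ n) a) :
    a ∉ MulAction.orbit (Subgroup.closure {reglue t a b, p}) b := by
  obtain ⟨k, hk, hmin⟩ : ∃ k, b = ((p * t) ^ k) a ∧ ∀ m < k, b ≠ ((p * t) ^ m) a :=
    ⟨Nat.find h, Nat.find_spec h, fun m hm => Nat.find_min h hm⟩
  have hodd := invol_pow_apply_ne_pow_apply ht hp ht' hp'
  have hab' : a ≠ t b := fun h => hodd k 0 a (by rw [← hk, ← h]; rfl)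
  have hkpos : 0 < k := Nat.pos_of_ne_zero fun h => hab (by simp [hk, h])
  have hreturn : ∀ i, 0 < i → i ≤ k → ((p * t) ^ i) a ≠ a := fun i hi hik h => by
    refine hmin (k - i) (by omega) ?_
    conv_rhs => rw [← h]
    rw [← Equiv.Perm.mul_apply, ← pow_add, show k - i + i = k by omega, hk]
  let A : X → Prop := fun y => (∃ i, 0 < i ∧ i ≤ k ∧ y = ((p * t) ^ i) a) ∨
    ∃ i < k, y = t (((p * t) ^ i) a)
  have hAb : A b := Or.inl ⟨k, hkpos, le_rfl, hk⟩
  have hAta : A (t a) := Or.inr ⟨0, hkpos, rfl⟩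
  have hAa : ¬ A a := by
    rintro (⟨i, hi, hik, h⟩ | ⟨i, _, h⟩)
    · exact hreturn i hi hik h.symm
    · exact hodd i 0 a (by rw [← h]; rfl)
  have hAtb : ¬ A (t b) := by
    rintro (⟨i, _, _, h⟩ | ⟨i, hi, h⟩)
    · exact hodd k i a (by rw [← h, hk])
    · exact hmin i hi (t.injective h)
  have hAt : ∀ x, x ≠ b → x ≠ t a → A x → A (t x) := by
    rintro x hxb hxta (⟨i, hi, hik, rfl⟩ | ⟨i, hik, rfl⟩)
    · have : i ≠ k := fun h => hxb (by rw [h, hk])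
      exact Or.inr ⟨i, by omega, rfl⟩
    · have : i ≠ 0 := fun h => hxta (by rw [h]; rfl)
      exact Or.inl ⟨i, by omega, by omega, ht _⟩
  have hAp : ∀ x, A x → A (p x) := by
    rintro _ (⟨i, hi, hik, rfl⟩ | ⟨i, hik, rfl⟩)
    · obtain ⟨j, rfl⟩ : ∃ j, i = j + 1 := ⟨i - 1, by omega⟩
      exact Or.inr ⟨j, by omega, by rw [pow_succ']; exact hp _⟩
    · exact Or.inl ⟨i + 1, by omega, by omega, by rw [pow_succ']; rfl⟩
  intro hmem
  have hs : Setoid.comap A ⊥ a b := by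
    refine rel_of_mem_orbit_closure_pair _ (fun z => ?_) (fun z => ?_) hmem
    · refine forall_reglue (Q := fun y x => Setoid.comap A ⊥ y x) ht ht' hab' ?_ ?_ ?_ ?_
        (fun x hxa hxb hxta hxtb => ?_) z
      · exact propext (iff_of_false hAtb hAa)
      · exact propext (iff_of_true hAta hAb)
      · exact propext (iff_of_true hAb hAta)
      · exact propext (iff_of_false hAa hAtb)
      · refine propext ⟨fun h => ?_, hAt x hxb hxta⟩
        rw [← ht x]
        exact hAt _ (fun h => hxtb (by rw [← h, ht])) (fun h => hxa (t.injective h)) h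
    · exact propext ⟨fun h => by simpa [hp] using hAp _ h, hAp z⟩
  have hAab : A a = A b := hs
  exact hAa (hAab ▸ hAb)

/-- Regluing two lines of the same orbit with matching orientations adds exactly one orbit. -/
theorem card_orbits_reglue [Finite X] (ht : ∀ x, t (t x) = x) (hp : ∀ x, p (p x) = x)
    (ht' : ∀ x, t x ≠ x) (hp' : ∀ x, p x ≠ x) {a b : X} (hab : a ≠ b) (hab' : a ≠ t b)
    (h : ∃ n : ℕ, b = ((p * t) ^ n) a) :
    Nat.card (MulAction.orbitRel.Quotient (Subgroup.closure {reglue t a b, p}) X) =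
      Nat.card (MulAction.orbitRel.Quotient (Subgroup.closure {t, p}) X) + 1 := by
  let s := MulAction.orbitRel (Subgroup.closure {t, p}) X
  let s' := MulAction.orbitRel (Subgroup.closure {reglue t a b, p}) X
  have hst : ∀ x, s (t x) x := left_mem_orbit_closure_pair t p
  have hsp : ∀ x, s (p x) x := right_mem_orbit_closure_pair t p
  have hst' : ∀ x, s' (reglue t a b x) x := left_mem_orbit_closure_pair _ p
  have hsp' : ∀ x, s' (p x) x := right_mem_orbit_closure_pair _ p
  have hsab : s a b := by
    obtain ⟨n, rfl⟩ := h
    exact s.symm ⟨⟨(p * t) ^ n, pow_mem (mul_mem (Subgroup.subset_closure (by simp))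
      (Subgroup.subset_closure (by simp))) n⟩, rfl⟩
  have hle : ∀ x y, s' x y → s x y := fun x y hxy => by
    refine rel_of_mem_orbit_closure_pair s (fun z => ?_) hsp hxy
    refine forall_reglue (Q := fun y x => s y x) ht ht' hab' (s.trans (hst b) (s.symm hsab))
      (s.trans (hst a) hsab) ?_ ?_ (fun x _ _ _ _ => hst x) z
    · exact s.symm (s.trans (hst a) hsab)
    · exact s.trans hsab (s.symm (hst b))
  have htb : s' (t b) a := by simpa [reglue_apply_left ht' hab'] using hst' a
  have hta : s' (t a) b := by simpa [reglue_apply_right ht ht' hab'] using hst' b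
  let E : X → Prop := fun x => s' x a ∨ s' x b
  let r : Setoid X :=
    { r := fun x y => s' x y ∨ E x ∧ E y
      iseqv :=
        { refl := fun x => Or.inl (s'.refl x)
          symm := fun h => h.imp s'.symm And.symm
          trans := by
            rintro x y z (h₁ | ⟨hx, hy⟩) (h₂ | ⟨hy', hz⟩)
            · exact Or.inl (s'.trans h₁ h₂)
            · exact Or.inr ⟨hy'.imp (s'.trans h₁) (s'.trans h₁), hz⟩
            · exact Or.inr ⟨hx, hy.imp (s'.trans (s'.symm h₂)) (s'.trans (s'.symm h₂))⟩
            · exact Or.inr ⟨hx, hz⟩ } }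
  have hrt : ∀ x, r (t x) x := fun x => by
    by_cases hxa : x = a
    · exact hxa ▸ Or.inr ⟨Or.inr hta, Or.inl (s'.refl a)⟩
    by_cases hxb : x = b
    · exact hxb ▸ Or.inr ⟨Or.inl htb, Or.inr (s'.refl b)⟩
    by_cases hxta : x = t a
    · subst hxta
      exact Or.inr ⟨Or.inl (by rw [ht]), Or.inr hta⟩
    by_cases hxtb : x = t b
    · subst hxtb
      exact Or.inr ⟨Or.inr (by rw [ht]), Or.inl htb⟩
    exact Or.inl (by simpa [reglue_apply_of_ne hxa hxb hxta hxtb] using hst' x)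
  have hrs : ∀ x y, s x y → s' x y ∨ E x ∧ E y := fun x y hxy =>
    rel_of_mem_orbit_closure_pair r hrt (fun z => Or.inl (hsp' z)) hxy
  refine card_quotient_eq_add_one_of_merge s s' a b hle hsab
    (not_mem_orbit_reglue ht hp ht' hp' hab h) (fun x hx => ?_) fun x y hxy hxa => ?_
  · exact (hrs x a hx).elim Or.inl And.left
  · refine (hrs x y hxy).resolve_right fun h => hxa ?_
    exact h.1.elim (hle x a) fun hb => s.trans (hle x b hb) (s.symm hsab)

end RegluingInvolutions

/-- A fermionic line is determined by either of its darts. -/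
theorem PreGraph.IsLine.eq_of_mem {H : PreGraph q} {e : Set H.Dart} (h : H.IsLine e)
    {d : H.Dart} (hd : d ∈ e) : e = {d, H.ferm d} := by
  obtain ⟨c, rfl⟩ := h
  rcases hd with rfl | rfl
  · rfl
  · rw [H.ferm_invol, Set.pair_comm]

/-- If `e₁ ≠ e₂` are fermionic lines of an SYK graph `G`
belonging to a common face and `{e₁, e₂}` is not a 2-cut of `G₀`, then there
is an SYK graph `G'` with the same vertex set and disorder pairing as `G`,
whose fermionic pairing agrees with that of `G` outside `e₁ ∪ e₂`, with
`F(G') = F(G) + 1`. -/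
theorem syk_regluing_gains_one_face (q : ℕ) (hq : 2 ≤ q) (G : Graph q)
    (e₁ e₂ : Set G.toPreGraph.Dart)
    (h1 : G.toPreGraph.IsLine e₁) (h2 : G.toPreGraph.IsLine e₂)
    (hne : e₁ ≠ e₂) (hface : G.toPreGraph.LinesShareFace e₁ e₂)
    (hcut : ¬ G.toPreGraph.TwoCut0 e₁ e₂) :
    ∃ (f : Equiv.Perm (G.V × Fin q)) (hi : ∀ d, f (f d) = d)
      (hf : ∀ d, f d ≠ d),
      (∀ d, d ∉ e₁ ∪ e₂ → f d = G.ferm d) ∧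
      (G.toPreGraph.withFerm f hi hf).Conn0 ∧
      (G.toPreGraph.withFerm f hi hf).F = G.toPreGraph.F + 1 := by
  obtain ⟨a, ha, c, hc, hac⟩ := hface
  have hp : ∀ d, G.dishat (G.dishat d) = d := fun d => Prod.ext (G.dis_invol d.1) rfl
  have hp' : ∀ d, G.dishat d ≠ d := fun d h => G.dis_fpf d.1 (congrArg Prod.fst h)
  obtain ⟨b, hb, n, hn⟩ : ∃ b ∈ e₂, ∃ n : ℕ, b = ((G.dishat * G.ferm) ^ n) a := by
    obtain ⟨n, hn | hn⟩ := exists_pow_of_mem_orbit G.ferm_invol hp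
      ((MulAction.orbitRel G.faceGroup G.Dart).symm hac)
    · exact ⟨c, hc, n, hn⟩
    · refine ⟨G.ferm c, ?_, n, by rw [hn, G.ferm_invol]⟩
      rw [h2.eq_of_mem hc]
      exact Or.inr rfl
  have he₁ := h1.eq_of_mem ha
  have he₂ := h2.eq_of_mem hb
  have hab : a ≠ b := by
    rintro rfl
    exact hne (he₁.trans he₂.symm)
  have hab' : a ≠ G.ferm b := by
    rintro rfl
    rw [G.ferm_invol, Set.pair_comm] at he₁
    exact hne (he₁.trans he₂.symm)
  have hoff : ∀ d, d ∉ e₁ ∪ e₂ → reglue G.ferm a b d = G.ferm d := fun d hd => by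
    rw [he₁, he₂] at hd
    simp only [Set.mem_union, Set.mem_insert_iff, Set.mem_singleton_iff, not_or] at hd
    exact reglue_apply_of_ne hd.1.1 hd.2.1 hd.1.2 hd.2.2
  refine ⟨reglue G.ferm a b, reglue_reglue G.ferm_invol G.ferm_fpf hab',
    reglue_apply_ne G.ferm_invol G.ferm_fpf hab', hoff, fun v w => ?_,
    card_orbits_reglue G.ferm_invol hp G.ferm_fpf hp' hab hab' ⟨n, hn⟩⟩
  refine Relation.ReflTransGen.mono ?_ _ _ (not_not.mp hcut v w)
  rintro x y ⟨m, m', hm, hxy⟩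
  exact ⟨m, m', Set.notMem_empty _, (hoff _ hm).trans hxy⟩

end SYK
end
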